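/- Let n ≥ 2, κ ∈ ℝ, let Ω ⊆ ℝⁿ be a nonempty open convex set, and let ρ : Ω → ℝ be smooth with Hess ρ(x)(v,v) ≥ κ‖v‖² for all x ∈ Ω, v ∈ ℝⁿ (the CD(κ,∞) condition in the Euclidean setting). Let μ be the measure on Ω with density e^{−ρ} with respect to Lebesgue measure. Let f : Ω → ℝ be μ-integrable with ∫_Ω f dμ = 0, and suppose there exists x₀ ∈ Ω with ∫_Ω |f(x)|·‖x−x₀‖ dμ(x) < ∞. Then there exist a partition of Ω into pairwise disjoint nonempty sets {I_q}_{q∈Q}, each of which is the image of a map γ : A → Ω on a connected set A ⊆ ℝ with ‖γ(s)−γ(t)‖ = |s−t| for all s,t ∈ A (a unit-speed line segment, possibly a single point), together with a measure ν on the index set Q and a family of measures (μ_q)_{q∈Q} on Ω, such that: (i) for every Lebesgue-measurable A ⊆ Ω the map q ↦ μ_q(A) is ν-measurable and μ(A) = ∫_Q μ_q(A) dν(q); (ii) for ν-almost every q, μ_q is supported on I_q, and either I_q is a singleton or μ_q is a CD(κ,∞)-needle; (iii) for ν-almost every q, ∫_{I_q} f dμ_q = 0. (Localization theorem, Euclidean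 case with N = ∞.) -/

import Mathlib

open MeasureTheory
open scoped ENNReal

/-- A measure `η` on `Ω ⊆ ℝⁿ` is a `CD(κ,∞)`-needle: the pushforward, under a unit-speed
parametrization `γ` of a segment, of a measure `e^{-Ψ}dt` on a nonempty open interval
`A ⊆ ℝ`, where `Ψ` is smooth with `Ψ'' ≥ κ` on `A`. -/
def IsCDNeedle {n : ℕ} (κ : ℝ) (Ω : Set (EuclideanSpace ℝ (Fin n)))
    (η : Measure (EuclideanSpace ℝ (Fin n))) : Prop :=
  ∃ (A : Set ℝ) (Ψ : ℝ → ℝ) (γ : ℝ → EuclideanSpace ℝ (Fin n)),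
    A.Nonempty ∧ IsOpen A ∧ A.OrdConnected ∧
    ContDiffOn ℝ (⊤ : ℕ∞) Ψ A ∧ (∀ t ∈ A, κ ≤ deriv (deriv Ψ) t) ∧
    Measurable γ ∧ (∀ t ∈ A, γ t ∈ Ω) ∧
    (∀ s ∈ A, ∀ t ∈ A, ‖γ s - γ t‖ = |s - t|) ∧
    η = Measure.map γ
      ((volume.restrict A).withDensity fun t => ENNReal.ofReal (Real.exp (-Ψ t)))

namespace NL

set_option linter.unusedSectionVars false
set_option linter.unusedSimpArgs false

section geom
variable {E : Type*} [NormedAddCommGroup E] [InnerProductSpace ℝ E]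

def Lip1 (u : E → ℝ) : Prop := ∀ x y, u x - u y ≤ ‖x - y‖

def Seg (u : E → ℝ) (x e : E) (a b : ℝ) : Prop :=
  ‖e‖ = 1 ∧ u (x - a • e) = u x - a ∧ u (x + b • e) = u x + b

lemma Lip1.abs {u : E → ℝ} (hu : Lip1 u) (x y : E) : |u x - u y| ≤ ‖x - y‖ := by
  rw [abs_le]; constructor
  · have := hu y x; rw [norm_sub_rev] at this; linarith
  · exact hu x y

lemma Lip1.neg {u : E → ℝ} (hu : Lip1 u) : Lip1 (fun x => - u x) := by
  intro x y; have := hu y x; rw [norm_sub_rev] at this; linarith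

lemma Lip1.lip {u : E → ℝ} (hu : Lip1 u) : LipschitzWith 1 u := by
  apply LipschitzWith.of_dist_le_mul
  intro x y; rw [Real.dist_eq, dist_eq_norm]; simpa using hu.abs x y

lemma Lip1.cont {u : E → ℝ} (hu : Lip1 u) : Continuous u := hu.lip.continuous

lemma Seg.mono {u : E → ℝ} (hu : Lip1 u) {x e : E} {a b a' b' : ℝ} (h : Seg u x e a b)
    (ha0 : 0 ≤ a') (ha : a' ≤ a) (hb0 : 0 ≤ b') (hb : b' ≤ b) : Seg u x e a' b' := by
  obtain ⟨he, h1, h2⟩ := h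
  refine ⟨he, ?_, ?_⟩
  · have e1 := hu (x - a' • e) (x - a • e)
    have e2 := hu x (x - a' • e)
    rw [show (x - a' • e) - (x - a • e) = (a - a') • e by module, norm_smul, he,
      Real.norm_of_nonneg (by linarith)] at e1
    rw [show x - (x - a' • e) = a' • e by module, norm_smul, he,
      Real.norm_of_nonneg (by linarith)] at e2
    linarith
  · have e1 := hu (x + b • e) (x + b' • e)
    have e2 := hu (x + b' • e) x
    rw [show (x + b • e) - (x + b' • e) = (b - b') • e by module, norm_smul, he,
      Real.norm_of_nonneg (by linarith)] at e1
    rw [show (x + b' • e) - x = b' • e by module, norm_smul, he,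
      Real.norm_of_nonneg (by linarith)] at e2
    linarith

lemma Seg.at {u : E → ℝ} (hu : Lip1 u) {x e : E} {a b t : ℝ} (h : Seg u x e a b)
    (ha : 0 ≤ a) (hb : 0 ≤ b) (h1 : -a ≤ t) (h2 : t ≤ b) : u (x + t • e) = u x + t := by
  rcases le_total 0 t with ht | ht
  · exact (h.mono hu le_rfl ha ht h2).2.2
  · have := (h.mono hu (a' := -t) (by linarith) (by linarith) le_rfl hb).2.1
    rw [show x + t • e = x - (-t) • e by module, this]; ring

lemma Seg.shift {u : E → ℝ} (hu : Lip1 u) {x e : E} {a b t : ℝ} (h : Seg u x e a b)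
    (ha : 0 ≤ a) (hb : 0 ≤ b) (h1 : -a ≤ t) (h2 : t ≤ b) :
    Seg u (x + t • e) e (a + t) (b - t) := by
  refine ⟨h.1, ?_, ?_⟩
  · rw [h.at hu ha hb h1 h2, show x + t • e - (a + t) • e = x - a • e by module, h.2.1]; ring
  · rw [h.at hu ha hb h1 h2, show x + t • e + (b - t) • e = x + b • e by module, h.2.2]; ring

lemma Seg.key {u : E → ℝ} (hu : Lip1 u) {x y e e' : E} {d : ℝ} (hd : 0 < d)
    (h : Seg u x e d d) (h' : Seg u y e' d d) : d * ‖e - e'‖ ≤ ‖x - y‖ := by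
  have h1 := hu (x + d • e) (y - d • e')
  have h2 := hu (y + d • e') (x - d • e)
  rw [h.2.2, h'.2.1] at h1
  rw [h'.2.2, h.2.1] at h2
  rw [show x + d • e - (y - d • e') = (x - y) + d • (e + e') by module] at h1
  rw [show y + d • e' - (x - d • e) = -((x - y) - d • (e + e')) by module, norm_neg] at h2
  have h3 := hu.abs x y
  set s := u x - u y with hs
  have n1 := norm_add_sq_real (x - y) (d • (e + e'))
  have n2 := norm_sub_sq_real (x - y) (d • (e + e'))
  have n3 : ‖d • (e + e')‖ ^ 2 + ‖d • (e - e')‖ ^ 2 = 4 * d ^ 2 := by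
    have := parallelogram_law_with_norm ℝ e e'
    rw [norm_smul, norm_smul, mul_pow, mul_pow, Real.norm_of_nonneg hd.le]
    rw [h.1, h'.1] at this
    nlinarith
  have n4 : ‖d • (e - e')‖ = d * ‖e - e'‖ := by rw [norm_smul, Real.norm_of_nonneg hd.le]
  rw [← n4]
  by_cases hc : 2 * d ≤ ‖x - y‖
  · refine le_trans ?_ hc
    rw [n4]
    have := norm_sub_le e e'
    rw [h.1, h'.1] at this
    nlinarith
  · push Not at hc
    have hs1 := (abs_le.1 h3).1
    have hs2 := (abs_le.1 h3).2
    apply le_of_sq_le_sq _ (norm_nonneg _) |> fun h => h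
    have q1 : (s + 2 * d) ^ 2 ≤ ‖(x - y) + d • (e + e')‖ ^ 2 :=
      pow_le_pow_left₀ (by linarith) (by linarith) 2
    have q2 : (-s + 2 * d) ^ 2 ≤ ‖(x - y) - d • (e + e')‖ ^ 2 :=
      pow_le_pow_left₀ (by linarith) (by linarith) 2
    nlinarith [sq_nonneg s]

lemma Seg.unique {u : E → ℝ} (hu : Lip1 u) {x e e' : E} {a b a' b' : ℝ} (ha : 0 < a) (hb : 0 < b)
    (ha' : 0 < a') (hb' : 0 < b')
    (h : Seg u x e a b) (h' : Seg u x e' a' b') : e = e' := by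
  set d := min (min a b) (min a' b') with hd
  have hd0 : 0 < d := by simp [hd, *]
  have := Seg.key hu hd0 (h.mono hu hd0.le (by simp [hd]) hd0.le (by simp [hd]))
    (h'.mono hu hd0.le (by simp [hd]) hd0.le (by simp [hd]))
  simp only [sub_self, norm_zero] at this
  have h0 : ‖e - e'‖ ≤ 0 := by
    by_contra hc; push Not at hc; nlinarith [mul_pos hd0 hc]
  simpa [sub_eq_zero] using h0

lemma Seg.quad {u : E → ℝ} (hu : Lip1 u) {x e : E} {d : ℝ} (hd : 0 < d) (h : Seg u x e d d)
    (y : E) : |u y - u x - inner ℝ e (y - x)| ≤ ‖y - x‖ ^ 2 / (2 * d) := by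
  have h1 := hu (x + d • e) y
  have h2 := hu y (x - d • e)
  rw [h.2.2, show x + d • e - y = d • e - (y - x) by module] at h1
  rw [h.2.1, show y - (x - d • e) = d • e + (y - x) by module] at h2
  set z := y - x
  have n1 := norm_sub_sq_real (d • e) z
  have n2 := norm_add_sq_real (d • e) z
  have n3 : ‖d • e‖ = d := by rw [norm_smul, h.1, Real.norm_of_nonneg hd.le, mul_one]
  rw [n3, real_inner_smul_left] at n1 n2
  have m1 : ‖d • e - z‖ ≤ d - inner ℝ e z + ‖z‖ ^ 2 / (2 * d) := by
    have : 2 * d * (d - inner ℝ e z + ‖z‖ ^ 2 / (2 * d)) = d ^ 2 + ‖d • e - z‖ ^ 2 := by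
      rw [n1]; field_simp; ring
    nlinarith [sq_nonneg (d - ‖d • e - z‖)]
  have m2 : ‖d • e + z‖ ≤ d + inner ℝ e z + ‖z‖ ^ 2 / (2 * d) := by
    have : 2 * d * (d + inner ℝ e z + ‖z‖ ^ 2 / (2 * d)) = d ^ 2 + ‖d • e + z‖ ^ 2 := by
      rw [n2]; field_simp; ring
    nlinarith [sq_nonneg (d - ‖d • e + z‖)]
  rw [abs_le]; constructor <;> linarith

/-- Points with a ray extending at least `a` below and `b` above. -/
def R (u : E → ℝ) (a b : ℝ) : Set E := {x | ∃ e, Seg u x e a b}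

/-- Interior points of rays. -/
def X (u : E → ℝ) : Set E := {x | ∃ d : ℝ, 0 < d ∧ x ∈ R u d d}

open Classical in
noncomputable def vf (u : E → ℝ) (x : E) : E :=
  if h : x ∈ X u then h.choose_spec.2.choose else 0

lemma vf_eq {u : E → ℝ} (hu : Lip1 u) {x e : E} {a b : ℝ} (ha : 0 < a) (hb : 0 < b)
    (h : Seg u x e a b) : vf u x = e := by
  have hx : x ∈ X u := ⟨min a b, by simp [*], e,
    h.mono hu (by simp [ha.le, hb.le]) (by simp) (by simp [ha.le, hb.le]) (by simp)⟩
  rw [vf, dif_pos hx]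
  exact Seg.unique hu hx.choose_spec.1 hx.choose_spec.1 ha hb hx.choose_spec.2.choose_spec h

lemma vf_seg {u : E → ℝ} (hu : Lip1 u) {x : E} {a b : ℝ} (ha : 0 < a) (hb : 0 < b)
    (h : x ∈ R u a b) : Seg u x (vf u x) a b := by
  obtain ⟨e, he⟩ := h
  rwa [vf_eq hu ha hb he]

lemma R_sub_X {u : E → ℝ} (hu : Lip1 u) {a b : ℝ} (ha : 0 < a) (hb : 0 < b) : R u a b ⊆ X u := by
  rintro x ⟨e, he⟩
  exact ⟨min a b, by simp [*], e,
    he.mono hu (by simp [ha.le, hb.le]) (by simp) (by simp [ha.le, hb.le]) (by simp)⟩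

lemma vf_norm {u : E → ℝ} {x : E} (h : x ∈ X u) : ‖vf u x‖ = 1 := by
  rw [vf, dif_pos h]; exact h.choose_spec.2.choose_spec.1

lemma vf_lip {u : E → ℝ} (hu : Lip1 u) {x y : E} {d : ℝ} (hd : 0 < d) (hx : x ∈ R u d d)
    (hy : y ∈ R u d d) : ‖vf u x - vf u y‖ ≤ d⁻¹ * ‖x - y‖ := by
  have := Seg.key hu hd (vf_seg hu hd hd hx) (vf_seg hu hd hd hy)
  rw [inv_mul_eq_div, le_div_iff₀ hd]; linarith

lemma vf_lipOn {u : E → ℝ} (hu : Lip1 u) {d : ℝ} (hd : 0 < d) :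
    LipschitzOnWith (Real.toNNReal d⁻¹) (vf u) (R u d d) := by
  apply LipschitzOnWith.of_dist_le_mul
  intro x hx y hy
  rw [dist_eq_norm, dist_eq_norm, Real.coe_toNNReal _ (by positivity)]
  exact vf_lip hu hd hx hy

lemma R_mono {u : E → ℝ} (hu : Lip1 u) {a b a' b' : ℝ}
    (ha0 : 0 ≤ a') (ha : a' ≤ a) (hb0 : 0 ≤ b') (hb : b' ≤ b) : R u a b ⊆ R u a' b' :=
  fun _ ⟨e, he⟩ => ⟨e, he.mono hu ha0 ha hb0 hb⟩

lemma R_closed [FiniteDimensional ℝ E] {u : E → ℝ} (hu : Lip1 u) (a b : ℝ) : IsClosed (R u a b) := by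
  have hc := hu.cont
  have h1 : IsClosed {p : E × Metric.sphere (0:E) 1 | u (p.1 - a • (p.2:E)) = u p.1 - a ∧
      u (p.1 + b • (p.2:E)) = u p.1 + b} := by
    apply IsClosed.inter
    · exact isClosed_eq (by fun_prop) (by fun_prop)
    · exact isClosed_eq (by fun_prop) (by fun_prop)
  have h2 := isClosedMap_fst_of_compactSpace _ h1
  convert h2 using 1
  ext x
  constructor
  · rintro ⟨e, he, h⟩
    exact ⟨(x, ⟨e, by simpa using he⟩), h, rfl⟩
  · rintro ⟨⟨_, e⟩, h, rfl⟩
    exact ⟨e, by simpa using e.2, h⟩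

lemma X_eq {u : E → ℝ} (hu : Lip1 u) : X u = ⋃ k : ℕ, R u (1 / ((k:ℝ) + 1)) (1 / ((k:ℝ) + 1)) := by
  ext x; constructor
  · rintro ⟨d, hd, hx⟩
    obtain ⟨k, hk⟩ := exists_nat_one_div_lt hd
    exact Set.mem_iUnion.2 ⟨k, R_mono hu (by positivity) hk.le (by positivity) hk.le hx⟩
  · intro h
    obtain ⟨k, hk⟩ := Set.mem_iUnion.1 h
    exact ⟨_, by positivity, hk⟩

/-- parameters of the open ray through x -/
def T (u : E → ℝ) (x : E) : Set ℝ :=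
  {t | ∃ a b : ℝ, 0 < a ∧ 0 < b ∧ -a < t ∧ t < b ∧ x ∈ R u a b}

def O (u : E → ℝ) (x : E) : Set E := (fun t : ℝ => x + t • vf u x) '' T u x

lemma T_open {u : E → ℝ} (x : E) : IsOpen (T u x) := by
  rw [isOpen_iff_mem_nhds]
  rintro t ⟨a, b, ha, hb, h1, h2, h⟩
  filter_upwards [Ioo_mem_nhds h1 h2] with s hs
  exact ⟨a, b, ha, hb, hs.1, hs.2, h⟩

lemma T_Ioo {u : E → ℝ} {x : E} {a b : ℝ} (ha : 0 < a) (hb : 0 < b) (h : x ∈ R u a b) :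
    Set.Ioo (-a) b ⊆ T u x := fun _ ht => ⟨a, b, ha, hb, ht.1, ht.2, h⟩

lemma zero_mem_T {u : E → ℝ} {x : E} (h : x ∈ X u) : (0:ℝ) ∈ T u x := by
  obtain ⟨d, hd, hx⟩ := h
  exact ⟨d, d, hd, hd, by simpa, hd, hx⟩

lemma T_pair {u : E → ℝ} (hu : Lip1 u) {x : E} {s t : ℝ} (hs : s ∈ T u x) (ht : t ∈ T u x) :
    ∃ a b : ℝ, 0 < a ∧ 0 < b ∧ -a < s ∧ s < b ∧ -a < t ∧ t < b ∧ x ∈ R u a b := by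
  obtain ⟨a, b, ha, hb, h1, h2, h⟩ := hs
  obtain ⟨a', b', ha', hb', h1', h2', h'⟩ := ht
  have k := vf_seg hu ha hb h
  have k' := vf_seg hu ha' hb' h'
  refine ⟨max a a', max b b', by simp [ha], by simp [hb], ?_, ?_, ?_, ?_, ?_⟩
  · have := le_max_left a a'; linarith
  · have := le_max_left b b'; linarith
  · have := le_max_right a a'; linarith
  · have := le_max_right b b'; linarith
  · refine ⟨vf u x, k.1, ?_, ?_⟩
    · rcases max_choice a a' with h | h <;> rw [h]
      · exact k.2.1
      · exact k'.2.1
    · rcases max_choice b b' with h | h <;> rw [h]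
      · exact k.2.2
      · exact k'.2.2

lemma T_ord {u : E → ℝ} (hu : Lip1 u) (x : E) : (T u x).OrdConnected := by
  constructor
  intro s hs t ht r hr
  obtain ⟨a, b, ha, hb, h1, h2, h3, h4, h⟩ := T_pair hu hs ht
  exact ⟨a, b, ha, hb, by linarith [hr.1], by linarith [hr.2], h⟩

lemma T_shift {u : E → ℝ} (hu : Lip1 u) {x : E} {t : ℝ} (ht : t ∈ T u x) :
    x + t • vf u x ∈ X u ∧ vf u (x + t • vf u x) = vf u x ∧
      ∀ s, s ∈ T u (x + t • vf u x) ↔ s + t ∈ T u x := by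
  obtain ⟨a, b, ha, hb, h1, h2, h⟩ := ht
  have k := vf_seg hu ha hb h
  have k2 := k.shift hu ha.le hb.le h1.le h2.le
  have p1 : 0 < a + t := by linarith
  have p2 : 0 < b - t := by linarith
  have e := vf_eq hu p1 p2 k2
  have hX := R_sub_X hu p1 p2 ⟨_, k2⟩
  refine ⟨hX, e, fun s => ⟨?_, ?_⟩⟩
  · intro hs
    obtain ⟨a', b', ha', hb', h1', h2', h3', h4', h'⟩ := T_pair hu hs
      (t := -t) ⟨a + t, b - t, p1, p2, by linarith, by linarith, ⟨_, k2⟩⟩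
    have q := vf_seg hu ha' hb' h'
    rw [e] at q
    have q2 := q.shift hu ha'.le hb'.le h3'.le h4'.le
    rw [show x + t • vf u x + -t • vf u x = x by module] at q2
    exact ⟨a' + -t, b' - -t, by linarith, by linarith, by linarith, by linarith, ⟨_, q2⟩⟩
  · intro hs
    obtain ⟨a', b', ha', hb', h1', h2', h3', h4', h'⟩ := T_pair hu hs
      (t := t) ⟨a, b, ha, hb, h1, h2, h⟩
    have q := (vf_seg hu ha' hb' h').shift hu ha'.le hb'.le h3'.le h4'.le
    exact ⟨a' + t, b' - t, by linarith, by linarith, by linarith, by linarith, ⟨_, q⟩⟩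

lemma O_eq {u : E → ℝ} (hu : Lip1 u) {x z : E} (h : z ∈ O u x) :
    z ∈ X u ∧ vf u z = vf u x ∧ O u z = O u x := by
  obtain ⟨t, ht, rfl⟩ := h
  obtain ⟨h1, h2, h3⟩ := T_shift hu ht
  refine ⟨h1, h2, ?_⟩
  ext y
  simp only [O, Set.mem_image]
  rw [h2]
  constructor
  · rintro ⟨s, hs, rfl⟩
    exact ⟨s + t, (h3 s).1 hs, by module⟩
  · rintro ⟨s, hs, rfl⟩
    refine ⟨s - t, (h3 _).2 (by simpa using hs), by module⟩

lemma mem_O_self {u : E → ℝ} {x : E} (h : x ∈ X u) : x ∈ O u x :=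
  ⟨0, zero_mem_T h, by simp⟩

lemma Seg_neg {u : E → ℝ} {x e : E} {a b : ℝ} :
    Seg (fun x => - u x) x e a b ↔ Seg u x (-e) b a := by
  simp only [Seg, norm_neg, smul_neg, sub_neg_eq_add, ← sub_eq_add_neg]
  constructor
  · rintro ⟨h, h1, h2⟩; exact ⟨h, by linarith, by linarith⟩
  · rintro ⟨h, h1, h2⟩; exact ⟨h, by linarith, by linarith⟩

lemma R_neg {u : E → ℝ} {a b : ℝ} : R (fun x => - u x) a b = R u b a := by
  ext x; constructor
  · rintro ⟨e, he⟩; exact ⟨-e, Seg_neg.1 he⟩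
  · rintro ⟨e, he⟩; exact ⟨-e, Seg_neg.2 (by simpa using he)⟩

lemma X_neg {u : E → ℝ} : X (fun x => - u x) = X u := by
  ext x; simp only [X, R_neg]

/-- down-set -/
def Dn (u : E → ℝ) (K : Set E) : Set E := {x | ∃ y ∈ K, u y - u x = ‖y - x‖}

lemma Dn_seg {u : E → ℝ} {x y : E} (hxy : y ≠ x) (h : u y - u x = ‖y - x‖) :
    ∃ e, Seg u x e 0 ‖y - x‖ ∧ y = x + ‖y - x‖ • e := by
  have h0 : ‖y - x‖ ≠ 0 := by simpa [sub_eq_zero] using hxy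
  have he : y = x + ‖y - x‖ • (‖y - x‖⁻¹ • (y - x)) := by
    rw [smul_smul, mul_inv_cancel₀ h0]; module
  refine ⟨‖y - x‖⁻¹ • (y - x), ⟨?_, by simp, ?_⟩, he⟩
  · rw [norm_smul, norm_inv, norm_norm, inv_mul_cancel₀ h0]
  · rw [← he]; linarith

/-- a point below an interior point is on the open ray or a lower end point -/
lemma Dn_X {u : E → ℝ} (hu : Lip1 u) {x y : E} (hy : y ∈ X u) (h : u y - u x = ‖y - x‖) :
    x ∈ O u y ∨ (x ∉ X u ∧ ∃ b > 0, x ∈ R u 0 b) := by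
  by_cases hxy : y = x
  · left; rw [← hxy]; exact mem_O_self hy
  obtain ⟨e, hs, hy2⟩ := Dn_seg hxy h
  have h0 : 0 < ‖y - x‖ := by simpa [sub_eq_zero] using hxy
  by_cases hx : x ∈ X u
  · left
    obtain ⟨d, hd, hR⟩ := hx
    have k := vf_seg hu hd hd hR
    obtain ⟨d', hd', hR'⟩ := hy
    have k' := vf_seg hu hd' hd' hR'
    -- e = vf y
    have k3 : Seg u y e ‖y - x‖ 0 := by
      refine ⟨hs.1, ?_, by simp⟩
      have : y - ‖y - x‖ • e = x := by nth_rw 1 [hy2]; module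
      rw [this]; linarith
    -- upper: u (x + (L + d') vf y) ; direction e equals vf x
    have e1 : vf u x = e := by
      have : Seg u x e 0 ‖y-x‖ := hs
      -- use the key estimate at the midpoint
      set m := min d ‖y - x‖ with hm
      have hm0 : 0 < m := by simp [hm, hd, h0]
      have a1 := k.mono hu (a' := m) (b' := 0) hm0.le (by simp [hm]) le_rfl hd.le
      have a2 := hs.mono hu (a' := 0) (b' := m) le_rfl le_rfl hm0.le (by simp [hm])
      have b1 := hu (x + m • e) (x - m • vf u x)
      rw [a2.2.2, a1.2.1, show x + m • e - (x - m • vf u x) = m • (e + vf u x) by module, norm_smul,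
        Real.norm_of_nonneg hm0.le] at b1
      have b2 : 2 ≤ ‖e + vf u x‖ := by
        have : m * 2 ≤ m * ‖e + vf u x‖ := by linarith
        exact le_of_mul_le_mul_left this hm0
      have b3 := parallelogram_law_with_norm ℝ e (vf u x)
      rw [hs.1, k.1] at b3
      have b4 : ‖e - vf u x‖ = 0 := by
        nlinarith [norm_nonneg (e - vf u x), norm_nonneg (e + vf u x)]
      rw [norm_eq_zero, sub_eq_zero] at b4
      exact b4.symm
    have e2 : vf u y = e := by
      set m := min d' ‖y - x‖ with hm
      have hm0 : 0 < m := by simp [hm, hd', h0]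
      have a1 := k'.mono hu (a' := 0) (b' := m) le_rfl hd'.le hm0.le (by simp [hm])
      have a2 := k3.mono hu (a' := m) (b' := 0) hm0.le (by simp [hm]) le_rfl le_rfl
      have b1 := hu (y + m • vf u y) (y - m • e)
      rw [a1.2.2, a2.2.1, show y + m • vf u y - (y - m • e) = m • (e + vf u y) by module, norm_smul,
        Real.norm_of_nonneg hm0.le] at b1
      have b2 : 2 ≤ ‖e + vf u y‖ := by
        have : m * 2 ≤ m * ‖e + vf u y‖ := by linarith
        exact le_of_mul_le_mul_left this hm0
      have b3 := parallelogram_law_with_norm ℝ e (vf u y)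
      rw [hs.1, k'.1] at b3
      have b4 : ‖e - vf u y‖ = 0 := by
        nlinarith [norm_nonneg (e - vf u y), norm_nonneg (e + vf u y)]
      rw [norm_eq_zero, sub_eq_zero] at b4
      exact b4.symm
    have hx2 : x = y + (-‖y - x‖) • vf u y := by
      have : y - ‖y - x‖ • e = x := by nth_rw 1 [hy2]; module
      rw [e2, neg_smul, ← sub_eq_add_neg, this]
    -- extended segment at y
    have ky : Seg u y e (‖y - x‖ + d) d' := by
      refine ⟨hs.1, ?_, ?_⟩
      · have : y - (‖y - x‖ + d) • e = x - d • vf u x := by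
          rw [e1]; nth_rw 1 [hy2]; module
        rw [this, k.2.1]; linarith
      · rw [← e2]; exact k'.2.2
    refine ⟨-‖y - x‖, ⟨‖y - x‖ + d, d', by linarith, hd', by linarith, by linarith, ⟨e, ky⟩⟩, hx2.symm⟩
  · right; exact ⟨hx, ‖y - x‖, h0, e, hs⟩

end geom
end NL

namespace NL
open scoped Pointwise

section lipvol
variable {E : Type*} [NormedAddCommGroup E] [NormedSpace ℝ E] [FiniteDimensional ℝ E]
  [MeasurableSpace E] [BorelSpace E] (μ : Measure E) [μ.IsAddHaarMeasure]

lemma lip_vol (K : NNReal) : ∃ C : ℝ≥0∞, C ≠ ⊤ ∧ ∀ (f : E → E) (s : Set E),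
    LipschitzOnWith K f s → μ (f '' s) ≤ C * μ s := by
  have h0 : ENNReal.ofReal |(0 : E →L[ℝ] E).det| < ((2 : NNReal) : ℝ≥0∞) := by
    have : |(0 : E →L[ℝ] E).det| ≤ 1 := by
      rw [ContinuousLinearMap.det]
      simp only [ContinuousLinearMap.toLinearMap_zero, LinearMap.det_zero, abs_pow, abs_zero]
      exact pow_le_one₀ le_rfl zero_le_one
    calc ENNReal.ofReal |(0 : E →L[ℝ] E).det| ≤ ENNReal.ofReal 1 := ENNReal.ofReal_le_ofReal this
      _ = 1 := by simp
      _ < _ := by norm_num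
  have h1 := addHaar_image_le_mul_of_det_lt μ (0 : E →L[ℝ] E) h0
  obtain ⟨δ, hδ, hδ0⟩ := (h1.and self_mem_nhdsWithin).exists
  have hδ0 : 0 < δ := hδ0
  set r : NNReal := δ / (K + 1) with hr
  have hr0 : 0 < r := by positivity
  refine ⟨ENNReal.ofReal (|((r:ℝ)⁻¹) ^ Module.finrank ℝ E|) * 2, by finiteness, fun f s hf => ?_⟩
  have h2 := hδ s (fun x => (r:ℝ) • f x) (by
    intro x hx y hy
    simp only [zero_apply, sub_zero]
    rw [← smul_sub, norm_smul, Real.norm_of_nonneg (by positivity), ← dist_eq_norm, ← dist_eq_norm]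
    have h3 := hf.dist_le_mul x hx y hy
    have h4 : (r:ℝ) * K ≤ δ := by
      have : r * K ≤ δ := by
        rw [hr, div_mul_eq_mul_div, div_le_iff₀ (by positivity)]
        gcongr; simp
      exact_mod_cast this
    calc (r:ℝ) * dist (f x) (f y) ≤ r * (K * dist x y) := by gcongr
      _ = (r * K) * dist x y := by ring
      _ ≤ _ := by gcongr)
  have h3 : f '' s = (r:ℝ)⁻¹ • ((fun x => (r:ℝ) • f x) '' s) := by
    rw [← Set.image_smul, Set.image_image]
    apply Set.image_congr
    intro x _
    rw [smul_smul, inv_mul_cancel₀ (by positivity), one_smul]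
  rw [h3, Measure.addHaar_smul, mul_assoc]
  gcongr
  exact h2

lemma lip_null {f : E → E} {s : Set E} (K : ℕ → NNReal) (S : ℕ → Set E)
    (h : ∀ k, LipschitzOnWith (K k) f (s ∩ S k)) (hS : s ⊆ ⋃ k, S k) (h0 : μ s = 0) :
    μ (f '' s) = 0 := by
  have : f '' s ⊆ ⋃ k, f '' (s ∩ S k) := by
    rintro _ ⟨x, hx, rfl⟩
    obtain ⟨k, hk⟩ := Set.mem_iUnion.1 (hS hx)
    exact Set.mem_iUnion.2 ⟨k, x, ⟨hx, hk⟩, rfl⟩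
  refine measure_mono_null this (measure_iUnion_null fun k => ?_)
  obtain ⟨C, -, hC⟩ := lip_vol μ (K k)
  have := hC f _ (h k)
  rw [measure_mono_null Set.inter_subset_left h0, mul_zero] at this
  exact le_antisymm this (zero_le)

end lipvol

section ends
variable {E : Type*} [NormedAddCommGroup E] [InnerProductSpace ℝ E] [FiniteDimensional ℝ E]
  [MeasurableSpace E] [BorelSpace E] (μ : Measure E) [μ.IsAddHaarMeasure]

lemma X_meas {u : E → ℝ} (hu : Lip1 u) : MeasurableSet (X u) := by
  rw [X_eq hu]
  exact MeasurableSet.iUnion fun k => (R_closed hu _ _).measurableSet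

lemma ends_ball {u : E → ℝ} (hu : Lip1 u) {b : ℝ} (hb : 0 < b) (r : ℝ) :
    μ ((R u 0 b \ X u) ∩ Metric.closedBall 0 r) = 0 := by
  obtain ⟨C, hC, hlip⟩ := lip_vol μ 2
  set A := (R u 0 b \ X u) ∩ Metric.closedBall 0 r with hA
  set t : ℕ → ℝ := fun j => b / 2 / ((j:ℝ) + 1) with ht
  have ht0 : ∀ j, 0 < t j := fun j => by positivity
  have htb : ∀ j, t j ≤ b / 2 := fun j => by
    apply div_le_self (by positivity); linarith [(Nat.cast_nonneg j : (0:ℝ) ≤ j)]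
  have htinj : Function.Injective t := by
    intro i j hij
    simp only [ht] at hij
    rw [div_eq_div_iff (by positivity) (by positivity)] at hij
    have := mul_left_cancel₀ (by positivity : b / 2 ≠ 0) hij
    have : (i:ℝ) = j := by linarith
    exact_mod_cast this
  set W : ℕ → Set E := fun j => {z | z ∈ R u (t j) (t j) ∧ z - t j • vf u z ∈ A} with hW
  have hAm : MeasurableSet A :=
    ((R_closed hu _ _).measurableSet.diff (X_meas hu)).inter Metric.isClosed_closedBall.measurableSet
  have hWm : ∀ j, MeasurableSet (W j) := by
    intro j
    obtain ⟨g, hg, hge⟩ := (vf_lipOn hu (ht0 j)).extend_finite_dimension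
    have : W j = R u (t j) (t j) ∩ (fun z => z - t j • g z) ⁻¹' A := by
      ext z
      simp only [hW, Set.mem_inter_iff, Set.mem_preimage]
      constructor
      · rintro ⟨h1, h2⟩; refine ⟨h1, ?_⟩; rwa [← hge h1]
      · rintro ⟨h1, h2⟩; refine ⟨h1, ?_⟩; rwa [hge h1]
    rw [this]
    have hc := hg.continuous
    exact (R_closed hu _ _).measurableSet.inter
      ((by fun_prop : Continuous fun z => z - t j • g z).measurable hAm)
  have hdisj' : ∀ i j, t i < t j → Disjoint (W i) (W j) := by
    intro i j hij
    rw [Set.disjoint_left]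
    rintro z ⟨-, h2⟩ ⟨h3, -⟩
    apply h2.1.2
    have := (vf_seg hu (ht0 j) (ht0 j) h3).shift hu (t := - t i) (ht0 j).le (ht0 j).le
      (by linarith) (by linarith [ht0 i, ht0 j])
    rw [neg_smul, ← sub_eq_add_neg] at this
    exact R_sub_X hu (by linarith) (by linarith [ht0 i, ht0 j]) ⟨_, this⟩
  have hdisj : Pairwise (Function.onFun Disjoint W) := by
    intro i j hij
    rcases lt_trichotomy (t i) (t j) with h | h | h
    · exact hdisj' i j h
    · exact absurd (htinj h) hij
    · exact (hdisj' j i h).symm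
  have hbd : ∀ j, W j ⊆ Metric.closedBall 0 (r + b) := by
    rintro j z ⟨h1, h2⟩
    have h3 := h2.2
    have h4 := vf_norm (R_sub_X hu (ht0 j) (ht0 j) h1)
    rw [mem_closedBall_zero_iff] at h3 ⊢
    calc ‖z‖ = ‖(z - t j • vf u z) + t j • vf u z‖ := by congr 1; module
      _ ≤ ‖z - t j • vf u z‖ + ‖t j • vf u z‖ := norm_add_le _ _
      _ ≤ r + b := by
        rw [norm_smul, h4, Real.norm_of_nonneg (ht0 j).le]; linarith [htb j]
  have hle : ∀ j, μ A ≤ C * μ (W j) := by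
    intro j
    have hL : LipschitzOnWith 2 (fun z => z - t j • vf u z) (W j) := by
      apply LipschitzOnWith.of_dist_le_mul
      intro x hx y hy
      rw [dist_eq_norm, dist_eq_norm]
      have := Seg.key hu (ht0 j) (vf_seg hu (ht0 j) (ht0 j) hx.1) (vf_seg hu (ht0 j) (ht0 j) hy.1)
      calc ‖x - t j • vf u x - (y - t j • vf u y)‖ = ‖(x - y) - t j • (vf u x - vf u y)‖ := by
            congr 1; module
        _ ≤ ‖x - y‖ + ‖t j • (vf u x - vf u y)‖ := norm_sub_le _ _
        _ ≤ ‖x - y‖ + ‖x - y‖ := by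
            rw [norm_smul, Real.norm_of_nonneg (ht0 j).le]; linarith
        _ = _ := by push_cast; ring
    refine le_trans (measure_mono ?_) (hlip _ _ hL)
    rintro x hx
    obtain ⟨e, he⟩ := hx.1.1
    have k := he.shift hu (t := t j) le_rfl hb.le (by linarith [ht0 j]) (by linarith [htb j])
    have k2 := k.mono hu (a' := t j) (b' := t j) (ht0 j).le (by linarith) (ht0 j).le
      (by linarith [htb j])
    have e2 := vf_eq hu (ht0 j) (ht0 j) k2
    have e3 : x + t j • e - t j • vf u (x + t j • e) = x := by rw [e2]; module
    refine ⟨x + t j • e, ⟨⟨e, k2⟩, ?_⟩, e3⟩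
    rw [e3]; exact hx
  by_contra hne
  have hfin : μ (⋃ j, W j) ≠ ⊤ := by
    refine ne_top_of_le_ne_top ?_ (measure_mono (Set.iUnion_subset hbd))
    exact (isCompact_closedBall 0 (r+b)).measure_lt_top.ne
  rw [measure_iUnion hdisj hWm] at hfin
  have hC0 : C ≠ 0 := by
    rintro rfl
    have := hle 0
    simp at this
    exact hne this
  have : ∑' j : ℕ, (μ A / C) ≤ ∑' j, μ (W j) := by
    apply ENNReal.tsum_le_tsum
    intro j
    apply ENNReal.div_le_of_le_mul
    rw [mul_comm]; exact hle j
  rw [ENNReal.tsum_const_eq_top_of_ne_zero (ENNReal.div_ne_zero.2 ⟨hne, hC⟩)] at this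
  exact hfin (top_le_iff.1 this)

/-- lower end points -/
def Lo (u : E → ℝ) : Set E := {x | x ∉ X u ∧ ∃ b > 0, x ∈ R u 0 b}

lemma Lo_null {u : E → ℝ} (hu : Lip1 u) : μ (Lo u) = 0 := by
  have : Lo u ⊆ ⋃ k : ℕ, ⋃ j : ℕ, (R u 0 (1 / ((k:ℝ)+1)) \ X u) ∩ Metric.closedBall 0 j := by
    rintro x ⟨hx, b, hb, h⟩
    obtain ⟨k, hk⟩ := exists_nat_one_div_lt hb
    obtain ⟨j, hj⟩ := exists_nat_ge ‖x‖
    exact Set.mem_iUnion.2 ⟨k, Set.mem_iUnion.2 ⟨j, ⟨R_mono hu le_rfl le_rfl (by positivity) hk.le h, hx⟩,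
      by simpa using hj⟩⟩
  refine measure_mono_null this (measure_iUnion_null fun k => measure_iUnion_null fun j => ?_)
  exact ends_ball μ hu (by positivity) _

end ends
end NL

namespace NL
open scoped Pointwise

section opt
open Filter Topology
variable {E : Type*} [NormedAddCommGroup E] [InnerProductSpace ℝ E] [FiniteDimensional ℝ E]
  [MeasurableSpace E] [BorelSpace E] {μ : Measure E} {f : E → ℝ} {x₀ : E}

lemma int_mul (hf : Integrable f μ) (hfd : Integrable (fun x => |f x| * ‖x - x₀‖) μ)
    {g : E → ℝ} (hg : Lip1 g) : Integrable (fun x => g x * f x) μ := by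
  have h1 : Integrable (fun x => |g x₀| * |f x| + |f x| * ‖x - x₀‖) μ :=
    (hf.abs.const_mul _).add hfd
  refine h1.mono (hg.cont.aestronglyMeasurable.mul hf.1) (Eventually.of_forall fun x => ?_)
  rw [Real.norm_eq_abs, abs_mul, Real.norm_of_nonneg (by positivity)]
  have := hg.abs x x₀
  have h2 : |g x| ≤ |g x₀| + ‖x - x₀‖ := by
    have := abs_sub_abs_le_abs_sub (g x) (g x₀); linarith
  nlinarith [abs_nonneg (f x)]

lemma exists_opt (hf : Integrable f μ) (hf0 : ∫ x, f x ∂μ = 0)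
    (hfd : Integrable (fun x => |f x| * ‖x - x₀‖) μ) :
    ∃ u : E → ℝ, Lip1 u ∧ ∀ g, Lip1 g → ∫ x, g x * f x ∂μ ≤ ∫ x, u x * f x ∂μ := by
  set S : Set ℝ := {r | ∃ g : E → ℝ, Lip1 g ∧ g x₀ = 0 ∧ ∫ x, g x * f x ∂μ = r} with hS
  have hne : S.Nonempty := ⟨_, fun _ => 0, fun x y => by simp, rfl, rfl⟩
  have hbd : ∀ (g : E → ℝ), Lip1 g → g x₀ = 0 → ∀ x, ‖g x * f x‖ ≤ |f x| * ‖x - x₀‖ := by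
    intro g hg h0 x
    have := hg.abs x x₀
    rw [h0, sub_zero] at this
    rw [norm_mul, mul_comm, Real.norm_eq_abs, Real.norm_eq_abs]
    gcongr
  have hba : BddAbove S := by
    refine ⟨∫ x, |f x| * ‖x - x₀‖ ∂μ, ?_⟩
    rintro _ ⟨g, hg, h0, rfl⟩
    apply integral_mono (int_mul hf hfd hg) hfd
    intro x
    exact (le_abs_self _).trans (hbd g hg h0 x)
  obtain ⟨a, -, ha, haS⟩ := exists_seq_tendsto_sSup hne hba
  choose g hg hg0 hgi using haS
  -- compactness
  set D := TopologicalSpace.denseSeq E with hD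
  have hcomp : IsCompact (Set.pi Set.univ fun k : ℕ => Metric.closedBall (0:ℝ) ‖D k - x₀‖) :=
    isCompact_univ_pi fun k => isCompact_closedBall _ _
  obtain ⟨l, -, φ, hφ, hl⟩ := hcomp.tendsto_subseq (x := fun j k => g j (D k)) (by
    intro j k _
    have := (hg j).abs (D k) x₀
    rw [hg0 j, sub_zero] at this
    simpa using this)
  have hl' : ∀ k, Tendsto (fun j => g (φ j) (D k)) atTop (𝓝 (l k)) := fun k => by
    have := (tendsto_pi_nhds.1 hl) k
    exact this
  have hconv : ∀ x, ∃ r, Tendsto (fun j => g (φ j) x) atTop (𝓝 r) := by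
    intro x
    apply cauchySeq_tendsto_of_complete
    rw [Metric.cauchySeq_iff']
    intro ε hε
    obtain ⟨k, hk⟩ := (TopologicalSpace.denseRange_denseSeq E).exists_dist_lt x (by positivity : 0 < ε / 3)
    obtain ⟨N, hN⟩ := Metric.cauchySeq_iff'.1 (hl' k).cauchySeq (ε / 3) (by positivity)
    refine ⟨N, fun j hj => ?_⟩
    have h1 := hN j hj
    have h2 := (hg (φ j)).abs x (D k)
    have h3 := (hg (φ N)).abs (D k) x
    rw [dist_eq_norm] at hk
    rw [norm_sub_rev] at h3
    rw [Real.dist_eq] at h1 ⊢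
    have hk' : ‖x - D k‖ < ε / 3 := hk
    calc |g (φ j) x - g (φ N) x| = |(g (φ j) x - g (φ j) (D k)) + (g (φ j) (D k) - g (φ N) (D k))
          + (g (φ N) (D k) - g (φ N) x)| := by congr 1; ring
      _ ≤ _ := abs_add_three _ _ _
      _ < ε := by linarith
  choose u hu using hconv
  have huL : Lip1 u := fun x y =>
    le_of_tendsto ((hu x).sub (hu y)) (Eventually.of_forall fun j => hg (φ j) x y)
  have hlim : Tendsto (fun j => ∫ x, g (φ j) x * f x ∂μ) atTop (𝓝 (∫ x, u x * f x ∂μ)) := by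
    apply tendsto_integral_of_dominated_convergence (fun x => |f x| * ‖x - x₀‖)
    · intro j; exact (int_mul hf hfd (hg _)).1
    · exact hfd
    · intro j; exact Eventually.of_forall fun x => hbd _ (hg _) (hg0 _) x
    · exact Eventually.of_forall fun x => (hu x).mul_const _
  have hsup : ∫ x, u x * f x ∂μ = sSup S := by
    refine tendsto_nhds_unique hlim ?_
    have := ha.comp hφ.tendsto_atTop
    refine this.congr fun j => ?_
    simp [hgi]
  refine ⟨u, huL, fun h hh => ?_⟩
  rw [hsup]
  have h1 : ∫ x, h x * f x ∂μ = ∫ x, (h x - h x₀) * f x ∂μ := by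
    simp only [sub_mul]
    rw [integral_sub (int_mul hf hfd hh) (hf.const_mul _), integral_const_mul, hf0]; simp
  rw [h1]
  apply le_csSup hba
  exact ⟨fun x => h x - h x₀, fun x y => by have := hh x y; simpa using this, by simp, rfl⟩

lemma Dn_closed {u : E → ℝ} (hu : Lip1 u) {K : Set E} (hK : IsCompact K) : IsClosed (Dn u K) := by
  have hc := hu.cont
  haveI : CompactSpace K := isCompact_iff_compactSpace.1 hK
  have h1 : IsClosed {p : E × K | u p.2 - u p.1 = ‖(p.2:E) - p.1‖} :=
    isClosed_eq (by fun_prop) (by fun_prop)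
  have h2 := isClosedMap_fst_of_compactSpace _ h1
  convert h2 using 1
  ext x
  constructor
  · rintro ⟨y, hy, h⟩
    exact ⟨(x, ⟨y, hy⟩), h, rfl⟩
  · rintro ⟨⟨_, y⟩, h, rfl⟩
    exact ⟨y, y.2, h⟩

lemma var_le (hf : Integrable f μ)
    (hfd : Integrable (fun x => |f x| * ‖x - x₀‖) μ)
    {u : E → ℝ} (hu : Lip1 u) (hopt : ∀ g, Lip1 g → ∫ x, g x * f x ∂μ ≤ ∫ x, u x * f x ∂μ)
    {K : Set E} (hK : IsCompact K) : ∫ x in Dn u K, f x ∂μ ≤ 0 := by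
  rcases K.eq_empty_or_nonempty with rfl | hKne
  · simp [Dn]
  have hc := hu.cont
  have hmax : ∀ x, ∃ y ∈ K, ∀ z ∈ K, u z - ‖x - z‖ ≤ u y - ‖x - y‖ := by
    intro x
    obtain ⟨y, hy, h⟩ := hK.exists_isMaxOn hKne (f := fun z => u z - ‖x - z‖)
      (by fun_prop : Continuous fun z => u z - ‖x - z‖).continuousOn
    exact ⟨y, hy, fun z hz => h hz⟩
  choose y hy hmax using hmax
  set m : E → ℝ := fun x => u (y x) - ‖x - y x‖ with hm
  have hmL : Lip1 m := by
    intro x z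
    have h1 := hmax z (y x) (hy x)
    have h2 : ‖z - y x‖ ≤ ‖x - y x‖ + ‖x - z‖ := by
      calc ‖z - y x‖ = ‖(x - y x) - (x - z)‖ := by congr 1; module
        _ ≤ _ := norm_sub_le _ _
    simp only [hm]; linarith
  have hmu : ∀ x, m x ≤ u x := by
    intro x
    have := hu (y x) x
    rw [norm_sub_rev] at this
    simp only [hm]; linarith
  have hD : ∀ x, x ∈ Dn u K ↔ m x = u x := by
    intro x; constructor
    · rintro ⟨z, hz, h⟩
      have := hmax x z hz
      apply le_antisymm (hmu x)
      simp only [hm]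
      rw [norm_sub_rev] at h
      linarith
    · intro h
      refine ⟨y x, hy x, ?_⟩
      simp only [hm] at h
      rw [norm_sub_rev]; linarith
  set w : ℕ → E → ℝ := fun k x => max 0 (1 - ((k:ℝ) + 1) * (u x - m x)) with hw
  have hw01 : ∀ k x, |w k x| ≤ 1 := by
    intro k x
    rw [abs_of_nonneg (le_max_left _ _)]
    apply max_le zero_le_one
    have : 0 ≤ ((k:ℝ) + 1) * (u x - m x) := mul_nonneg (by positivity) (by linarith [hmu x])
    linarith
  have hwc : ∀ k, Continuous (w k) := fun k => by
    have := hmL.cont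
    simp only [hw]; fun_prop
  have hwi : ∀ k, Integrable (fun x => w k x * f x) μ := fun k => by
    refine hf.mono ((hwc k).aestronglyMeasurable.mul hf.1) (Eventually.of_forall fun x => ?_)
    rw [norm_mul]
    exact mul_le_of_le_one_left (norm_nonneg _) (hw01 k x)
  have hle : ∀ k, ∫ x, w k x * f x ∂μ ≤ 0 := by
    intro k
    set ε : ℝ := 1 / ((k:ℝ) + 1) with hε
    have hε0 : 0 < ε := by positivity
    have hg : Lip1 (fun x => max (u x) (m x + ε)) := by
      intro x z
      have h1 := hu x z
      have h2 := hmL x z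
      have := le_max_left (u z) (m z + ε)
      have := le_max_right (u z) (m z + ε)
      rw [sub_le_iff_le_add]
      apply max_le <;> linarith
    have h1 := hopt _ hg
    have h2 : ∀ x, max (u x) (m x + ε) * f x = u x * f x + ε * (w k x * f x) := by
      intro x
      have : max (u x) (m x + ε) = u x + ε * w k x := by
        simp only [hw]
        rw [mul_max_of_nonneg _ _ hε0.le, mul_zero, ← max_add_add_left, add_zero]
        congr 1
        rw [hε]; field_simp; ring
      rw [this]; ring
    simp only [h2] at h1
    rw [integral_add (int_mul hf hfd hu) ((hwi k).const_mul _), integral_const_mul] at h1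
    nlinarith
  have hlim : Tendsto (fun k => ∫ x, w k x * f x ∂μ) atTop (𝓝 (∫ x, (Dn u K).indicator f x ∂μ)) := by
    apply tendsto_integral_of_dominated_convergence (fun x => ‖f x‖)
    · intro k; exact (hwi k).1
    · exact hf.norm
    · intro k; refine Eventually.of_forall fun x => ?_
      rw [norm_mul]
      exact mul_le_of_le_one_left (norm_nonneg _) (hw01 k x)
    · refine Eventually.of_forall fun x => ?_
      by_cases hx : x ∈ Dn u K
      · rw [Set.indicator_of_mem hx]
        have h := (hD x).1 hx
        have : ∀ k, w k x = 1 := fun k => by simp [hw, h]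
        simp [this]
      · rw [Set.indicator_of_notMem hx]
        have h : 0 < u x - m x := by
          have := lt_of_le_of_ne (hmu x) (fun h => hx ((hD x).2 h)); linarith
        apply tendsto_const_nhds.congr'
        obtain ⟨N, hN⟩ := exists_nat_gt (1 / (u x - m x))
        filter_upwards [eventually_ge_atTop N] with k hk
        have : w k x = 0 := by
          simp only [hw]
          apply max_eq_left
          rw [div_lt_iff₀ h] at hN
          have : (N:ℝ) ≤ k := by exact_mod_cast hk
          nlinarith
        rw [this, zero_mul]
  rw [integral_indicator (Dn_closed hu hK).measurableSet] at hlim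
  exact le_of_tendsto' hlim hle

lemma bal_le (hf : Integrable f μ)
    (hfd : Integrable (fun x => |f x| * ‖x - x₀‖) μ)
    {u : E → ℝ} (hu : Lip1 u) (hopt : ∀ g, Lip1 g → ∫ x, g x * f x ∂μ ≤ ∫ x, u x * f x ∂μ)
    {S : Set E} (hS : MeasurableSet S) (hD : μ (Dn u S \ S) = 0) : ∫ x in S, f x ∂μ ≤ 0 := by
  apply le_of_forall_pos_le_add
  intro ε hε
  set σ : Measure E := μ.withDensity fun x => ‖f x‖ₑ with hσ
  haveI : IsFiniteMeasure σ := isFiniteMeasure_withDensity hf.2.ne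
  obtain ⟨K, hKS, hK, hlt⟩ := hS.exists_isCompact_sdiff_lt (μ := σ) (measure_ne_top _ _)
    (ε := ENNReal.ofReal ε) (by simpa using hε)
  have hm := (Dn_closed hu hK).measurableSet
  have hKD : K ⊆ Dn u K := fun x hx => ⟨x, hx, by simp⟩
  have hDD : Dn u K ⊆ Dn u S := fun x ⟨y, hy, h⟩ => ⟨y, hKS hy, h⟩
  have h1 := var_le hf hfd hu hopt hK
  -- ∫_S f = ∫_{K} + ∫_{S\K}; ∫_{Dn K} = ∫_{Dn K ∩ S}
  have h2 : ∫ x in Dn u K, f x ∂μ = ∫ x in Dn u K ∩ S, f x ∂μ := by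
    apply setIntegral_congr_set
    rw [ae_eq_set]
    constructor
    · refine measure_mono_null ?_ hD
      rintro x ⟨hx, hx2⟩
      exact ⟨hDD hx, fun h => hx2 ⟨hx, h⟩⟩
    · have : (Dn u K ∩ S) \ Dn u K = ∅ := by ext; simp; tauto
      simp [this]
  have h3 : ∫ x in S, f x ∂μ = ∫ x in S ∩ Dn u K, f x ∂μ + ∫ x in S \ Dn u K, f x ∂μ :=
    (integral_inter_add_sdiff hm hf.integrableOn).symm
  have h4 : ∫ x in S \ Dn u K, f x ∂μ ≤ ε := by
    refine (le_abs_self _).trans ?_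
    rw [← Real.norm_eq_abs]
    refine (norm_integral_le_lintegral_norm _).trans ?_
    apply ENNReal.toReal_le_of_le_ofReal hε.le
    refine le_trans ?_ hlt.le
    rw [hσ, withDensity_apply _ (hS.diff hK.measurableSet)]
    simp only [ofReal_norm_eq_enorm]
    exact lintegral_mono_set (Set.sdiff_subset_sdiff_right hKD)
  rw [h3, Set.inter_comm, ← h2]
  linarith

lemma bal_eq (hf : Integrable f μ)
    (hfd : Integrable (fun x => |f x| * ‖x - x₀‖) μ)
    {u : E → ℝ} (hu : Lip1 u) (hopt : ∀ g, Lip1 g → ∫ x, g x * f x ∂μ ≤ ∫ x, u x * f x ∂μ)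
    {S : Set E} (hS : MeasurableSet S) (hD : μ (Dn u S \ S) = 0)
    (hU : μ (Dn (fun x => - u x) S \ S) = 0) : ∫ x in S, f x ∂μ = 0 := by
  apply le_antisymm (bal_le hf hfd hu hopt hS hD)
  have := bal_le (f := fun x => - f x) (x₀ := x₀) hf.neg (by simpa using hfd) hu.neg (by
    intro g hg
    have := hopt _ hg.neg
    simpa [integral_neg] using this) hS hU
  rw [integral_neg] at this
  linarith

end opt
end NL

namespace NL
open scoped Pointwise

section dens
open Filter Topology
variable {G : Type*} [NormedAddCommGroup G] [NormedSpace ℝ G] [FiniteDimensional ℝ G]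
  [MeasurableSpace G] [BorelSpace G] (μ : Measure G) [μ.IsAddHaarMeasure]

/-- every direction at `y` is approximated by points of `M` -/
def Dens (M : Set G) (y : G) : Prop :=
  ∀ c : G, ∃ cs : ℕ → G, Tendsto cs atTop (𝓝 c) ∧ ∀ n : ℕ, y + ((n:ℝ) + 1)⁻¹ • cs n ∈ M

lemma dens_of {M : Set G} {y : G} (hy : y ∈ M)
    (h : Tendsto (fun r => μ (M ∩ Metric.closedBall y r) / μ (Metric.closedBall y r))
      (𝓝[>] (0:ℝ)) (𝓝 1)) : Dens M y := by
  intro c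
  have hr : Tendsto (fun n : ℕ => ((n:ℝ) + 1)⁻¹) atTop (𝓝[>] (0:ℝ)) := by
    refine tendsto_nhdsWithin_iff.2 ⟨?_, Eventually.of_forall fun n => by
      show (0:ℝ) < _; positivity⟩
    simpa [one_div] using tendsto_one_div_add_atTop_nhds_zero_nat (𝕜 := ℝ)
  let S : ℕ → Set G := fun n => {c | y + ((n:ℝ) + 1)⁻¹ • c ∈ M}
  have hS : ∀ n, (S n).Nonempty := fun n => ⟨0, by simpa [S] using hy⟩
  have hlim : Tendsto (fun n => Metric.infDist c (S n)) atTop (𝓝 0) := by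
    rw [Metric.tendsto_atTop]
    intro ε hε
    have h1 := Measure.eventually_nonempty_inter_smul_of_density_one μ M y h
      (Metric.closedBall c (ε/2)) measurableSet_closedBall
      (Metric.measure_closedBall_pos μ c (by positivity)).ne'
    obtain ⟨N, hN⟩ := eventually_atTop.1 (hr.eventually h1)
    refine ⟨N, fun n hn => ?_⟩
    obtain ⟨z, hzM, hz⟩ := hN n hn
    obtain ⟨y', hy', z', hz', rfl⟩ := Set.mem_add.1 hz
    obtain ⟨v, hv, rfl⟩ := Set.mem_smul_set.1 hz'
    rw [Set.mem_singleton_iff] at hy'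
    subst hy'
    have h3 : Metric.infDist c (S n) ≤ dist c v := Metric.infDist_le_dist_of_mem hzM
    rw [dist_zero_right, Real.norm_of_nonneg Metric.infDist_nonneg]
    rw [Metric.mem_closedBall, dist_comm] at hv
    linarith
  have hex : ∀ n, ∃ v ∈ S n, dist c v < Metric.infDist c (S n) + ((n:ℝ)+1)⁻¹ := fun n =>
    (Metric.infDist_lt_iff (hS n)).1 (by have : (0:ℝ) < ((n:ℝ)+1)⁻¹ := by positivity
                                         linarith)
  choose cs h1 h2 using hex
  refine ⟨cs, ?_, h1⟩
  rw [tendsto_iff_dist_tendsto_zero]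
  refine squeeze_zero (fun _ => dist_nonneg) (fun n => (dist_comm _ _).le.trans (h2 n).le) ?_
  simpa using hlim.add (tendsto_nhdsWithin_iff.1 hr).1

lemma dens_ae {M : Set G} (hM : MeasurableSet M) : ∀ᵐ y ∂ μ, y ∈ M → Dens M y := by
  have h := Besicovitch.ae_tendsto_measure_inter_div μ M
  rw [ae_restrict_iff' hM] at h
  filter_upwards [h] with y h1 hy
  exact dens_of μ hy (h1 hy)
end dens

section blow
open Filter Topology
variable {G : Type*} [NormedAddCommGroup G] [NormedSpace ℝ G]
variable {E : Type*} [NormedAddCommGroup E] [InnerProductSpace ℝ E]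
variable {u : E → ℝ} {ι : G →L[ℝ] E} {p : E} {w : G → E} {B : G →L[ℝ] E} {y : G}

lemma lim_seq {F : Type*} [NormedAddCommGroup F] [NormedSpace ℝ F] {g : G → F} {g' : G →L[ℝ] F}
    (hg : HasFDerivAt g g' y) {c : G} {cs : ℕ → G} (hc : Tendsto cs atTop (𝓝 c)) :
    Tendsto (fun n : ℕ => ((n:ℝ)+1) • (g (y + ((n:ℝ)+1)⁻¹ • cs n) - g y)) atTop (𝓝 (g' c)) := by
  have := hg.hasFDerivWithinAt (s := Set.univ)
  refine HasFDerivWithinAt.lim this (d := fun n : ℕ => ((n:ℝ)+1)⁻¹ • cs n) ?_ (by simp) ?_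
  · have hr : Tendsto (fun n : ℕ => ((n:ℝ) + 1)⁻¹) atTop (𝓝 (0:ℝ)) := by
      simpa [one_div] using tendsto_one_div_add_atTop_nhds_zero_nat (𝕜 := ℝ)
    simpa using hr.smul hc
  refine hc.congr fun n => ?_
  rw [smul_smul, mul_inv_cancel₀ (by positivity), one_smul]

lemma blow_a {M : Set G} (hy : y ∈ M) (hB : HasFDerivAt w B y) (hd : Dens M y)
    (hw : ∀ z ∈ M, ‖w z‖ = 1) (c : G) : inner ℝ (B c) (w y) = 0 := by
  obtain ⟨cs, hc, hM⟩ := hd c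
  have h1 := lim_seq (hB.norm_sq) hc
  have h2 : ∀ n : ℕ, ((n:ℝ)+1) • (‖w (y + ((n:ℝ)+1)⁻¹ • cs n)‖^2 - ‖w y‖^2) = 0 := by
    intro n; rw [hw _ (hM n), hw _ hy]; simp
  have h3 := tendsto_nhds_unique h1 ((tendsto_const_nhds).congr fun n => (h2 n).symm)
  simp at h3
  rw [real_inner_comm]; exact h3

lemma blow_c (hu : Lip1 u) {M : Set G} {α β t : ℝ} (hy : y ∈ M) (hB : HasFDerivAt w B y)
    (hd : Dens M y) (hα : -α < t) (hβ : t < β) (hα0 : 0 < α) (hβ0 : 0 < β)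
    (hs : ∀ z ∈ M, Seg u (p + ι z) (w z) α β) (c : G) (b : ℝ)
    (h0 : ι c + t • B c + b • w y = 0) : B c = 0 := by
  obtain ⟨cs, hc, hM⟩ := hd c
  set ε : ℝ := min (t + α) (β - t) with hε
  have hεp : 0 < ε := lt_min (by linarith) (by linarith)
  have hε1 : ε ≤ t + α := min_le_left _ _
  have hε2 : ε ≤ β - t := min_le_right _ _
  have hr : Tendsto (fun n : ℕ => ((n:ℝ) + 1)⁻¹) atTop (𝓝 (0:ℝ)) := by
    simpa [one_div] using tendsto_one_div_add_atTop_nhds_zero_nat (𝕜 := ℝ)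
  have hrb : Tendsto (fun n : ℕ => ((n:ℝ) + 1)⁻¹ * b) atTop (𝓝 (0:ℝ)) := by
    simpa using hr.mul_const b
  have hev : ∀ᶠ n : ℕ in atTop, |((n:ℝ) + 1)⁻¹ * b| < ε/2 := by
    have := hrb.abs; rw [abs_zero] at this
    exact this.eventually_lt_const (by positivity)
  have hS0 : Seg u ((p + ι y) + t • w y) (w y) (ε/2) (ε/2) := by
    have := (hs y hy).shift hu hα0.le hβ0.le (t := t) (by linarith) (by linarith)
    exact this.mono hu (by linarith) (by linarith) (by linarith) (by linarith)
  have hineq : ∀ᶠ n : ℕ in atTop,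
      (ε/2) * ‖((n:ℝ)+1) • (w (y + ((n:ℝ)+1)⁻¹ • cs n) - w y)‖ ≤
      ‖ι (cs n) + t • (((n:ℝ)+1) • (w (y + ((n:ℝ)+1)⁻¹ • cs n) - w y))
        + b • w (y + ((n:ℝ)+1)⁻¹ • cs n)‖ := by
    filter_upwards [hev] with n hn
    obtain ⟨hn1, hn2⟩ := abs_lt.1 hn
    set z := y + ((n:ℝ)+1)⁻¹ • cs n with hz
    set r := ((n:ℝ)+1)⁻¹ with hrdef
    have hrp : (0:ℝ) < (n:ℝ)+1 := by positivity
    have h1 : Seg u ((p + ι z) + (t + r * b) • w z) (w z) (ε/2) (ε/2) := by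
      have := (hs z (hM n)).shift hu hα0.le hβ0.le (t := t + r * b) (by linarith) (by linarith)
      exact this.mono hu (by linarith) (by linarith) (by linarith) (by linarith)
    have h2 := h1.key hu (by positivity) hS0
    have h3 : ((p + ι z) + (t + r * b) • w z) - ((p + ι y) + t • w y)
        = r • (ι (cs n) + t • (((n:ℝ)+1) • (w z - w y)) + b • w z) := by
      have : r * ((n:ℝ)+1) = 1 := inv_mul_cancel₀ hrp.ne'
      have e1 : ι z = ι y + r • ι (cs n) := by rw [hz, map_add, map_smul]
      rw [e1, smul_add, smul_add, smul_comm t, smul_smul r ((n:ℝ)+1), this, one_smul]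
      module
    rw [h3, norm_smul, Real.norm_of_nonneg (by positivity)] at h2
    rw [norm_smul, Real.norm_of_nonneg hrp.le]
    have h4 := mul_le_mul_of_nonneg_left h2 hrp.le
    rw [← mul_assoc ((n:ℝ)+1) r, mul_inv_cancel₀ hrp.ne', one_mul] at h4
    linarith
  have hL := lim_seq hB hc
  have hwc : Tendsto (fun n : ℕ => w (y + ((n:ℝ)+1)⁻¹ • cs n)) atTop (𝓝 (w y)) := by
    have h5 : Tendsto (fun n : ℕ => y + ((n:ℝ)+1)⁻¹ • cs n) atTop (𝓝 y) := by
      simpa using (tendsto_const_nhds (x := y)).add (hr.smul hc)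
    exact hB.continuousAt.tendsto.comp h5
  have h6 := le_of_tendsto_of_tendsto (hL.norm.const_mul (ε/2))
    ((((ι.continuous.tendsto c).comp hc).add (hL.const_smul t)).add (hwc.const_smul b)).norm hineq
  rw [h0, norm_zero] at h6
  have : ‖B c‖ ≤ 0 := by
    by_contra hcon
    push Not at hcon
    nlinarith [mul_pos hεp hcon]
  simpa using this

lemma deriv_of_quad {ψ : G → ℝ} {g : G →L[ℝ] ℝ} {c : G} {C : ℝ}
    (h : ∀ d, |ψ d - ψ c - g (d - c)| ≤ C * ‖d - c‖^2) : HasFDerivAt ψ g c := by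
  apply HasFDerivAt.of_isLittleO
  have h1 : (fun d => ψ d - ψ c - g (d - c)) =O[𝓝 c] (fun d => ‖d - c‖^2) :=
    Asymptotics.IsBigO.of_bound C (Eventually.of_forall fun d => by
      simpa [Real.norm_eq_abs] using h d)
  refine h1.trans_isLittleO ?_
  have h2 : (fun d => ‖d - c‖^2) =o[𝓝 c] (fun d => ‖d - c‖) := by
    have : Tendsto (fun d => ‖d - c‖) (𝓝 c) (𝓝 0) := by
      have : Continuous fun d : G => ‖d - c‖ := by fun_prop
      simpa using this.tendsto c
    exact (Asymptotics.isLittleO_pow_id (𝕜 := ℝ) (n := 2) (by norm_num)).comp_tendsto this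
  exact h2.of_norm_right

lemma blow_b (hu : Lip1 u) {M : Set G} {δ : ℝ} (hδ : 0 < δ) (hy : y ∈ M) (hB : HasFDerivAt w B y)
    (hd : Dens M y) (hs : ∀ z ∈ M, Seg u (p + ι z) (w z) δ δ) (c d : G) :
    inner ℝ (B c) (ι d) = inner ℝ (B d) (ι c) := by
  let r : ℕ → ℝ := fun n => ((n:ℝ)+1)⁻¹
  have hrp : ∀ n, 0 < r n := fun n => by simp only [r]; positivity
  let φ : ℕ → G → ℝ := fun n c =>
    (u (p + ι (y + r n • c)) - u (p + ι y) - r n * inner ℝ (w y) (ι c)) / (r n)^2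
  have key : ∀ n z e, y + r n • z ∈ M →
      |φ n e - φ n z - inner ℝ (((n:ℝ)+1) • (w (y + r n • z) - w y)) (ι (e - z))|
        ≤ ‖ι (e - z)‖^2 / (2*δ) := by
    intro n z e hz
    have h1 := (hs _ hz).quad hu hδ (p + ι (y + r n • e))
    have h2 : (p + ι (y + r n • e)) - (p + ι (y + r n • z)) = r n • ι (e - z) := by
      simp only [map_add, map_smul, map_sub]; module
    rw [h2, norm_smul, Real.norm_of_nonneg (hrp n).le, inner_smul_right] at h1
    have h3 : φ n e - φ n z - inner ℝ (((n:ℝ)+1) • (w (y + r n • z) - w y)) (ι (e - z))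
       = (u (p + ι (y + r n • e)) - u (p + ι (y + r n • z)) - r n * inner ℝ (w (y + r n • z)) (ι (e - z))) / (r n)^2 := by
      have e2 : ((n:ℝ)+1) = (r n)⁻¹ := by simp [r]
      rw [e2]
      simp only [φ, inner_smul_left, inner_sub_left, map_sub, inner_sub_right, conj_trivial]
      have := (hrp n).ne'
      field_simp
      ring
    rw [h3, abs_div, abs_of_pos (pow_pos (hrp n) 2), div_le_iff₀ (pow_pos (hrp n) 2)]
    refine h1.trans (le_of_eq ?_)
    ring
  have hφ0 : ∀ n, φ n 0 = 0 := fun n => by simp [φ]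
  have hbd : ∀ n e, |φ n e| ≤ ‖ι e‖^2/(2*δ) := by
    intro n e
    have := key n 0 e (by simpa using hy)
    simpa [hφ0] using this
  let U : Ultrafilter ℕ := hyperfilter ℕ
  have hU : (U : Filter ℕ) ≤ atTop := by
    rw [← Nat.cofinite_eq_atTop]; exact hyperfilter_le_cofinite
  have hex : ∀ e, ∃ l, Tendsto (fun n => φ n e) U (𝓝 l) := by
    intro e
    obtain ⟨l, -, hl⟩ := (isCompact_Icc (a := -(‖ι e‖^2/(2*δ))) (b := ‖ι e‖^2/(2*δ))).ultrafilter_le_nhds'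
      (U.map (fun n => φ n e)) (by
        rw [Ultrafilter.mem_map]
        exact Filter.Eventually.of_forall (f := (U : Filter ℕ)) fun n => abs_le.1 (hbd n e))
    exact ⟨l, hl⟩
  choose ψ hψ using hex
  have hmain : ∀ z e, |ψ e - ψ z - inner ℝ (B z) (ι (e - z))| ≤ ‖ι (e - z)‖^2 / (2*δ) := by
    intro z e
    obtain ⟨cs, hc, hM⟩ := hd z
    have hL := (lim_seq hB hc).mono_left hU
    have hc' := hc.mono_left hU
    have hι : ∀ e, Tendsto (fun n => ι (e - cs n)) U (𝓝 (ι (e - z))) := fun e =>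
      (ι.continuous.tendsto _).comp (tendsto_const_nhds.sub hc')
    have hdiff : Tendsto (fun n => φ n z - φ n (cs n)) U (𝓝 0) := by
      have h1 : Tendsto (fun n => φ n z - φ n (cs n) -
          inner ℝ (((n:ℝ)+1) • (w (y + r n • cs n) - w y)) (ι (z - cs n))) U (𝓝 0) := by
        refine squeeze_zero_norm (fun n => key n (cs n) z (hM n)) ?_
        simpa using ((hι z).norm.pow 2).div_const (2*δ)
      have h2 := h1.add (hL.inner (𝕜 := ℝ) (hι z))
      rw [sub_self, map_zero, inner_zero_right, add_zero] at h2
      refine h2.congr fun n => ?_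
      simp only [r]; ring
    have hcs : Tendsto (fun n => φ n (cs n)) U (𝓝 (ψ z)) := by
      simpa using (hψ z).sub hdiff
    refine le_of_tendsto_of_tendsto (((hψ e).sub hcs).sub (hL.inner (𝕜 := ℝ) (hι e))).abs
      (((hι e).norm.pow 2).div_const (2*δ)) (Eventually.of_forall fun n => key n (cs n) e (hM n))
  let ψ'' : G →L[ℝ] G →L[ℝ] ℝ :=
    ((ContinuousLinearMap.compL ℝ G E ℝ).flip ι).comp ((innerSL ℝ).comp B)
  have happ : ∀ c d, ψ'' c d = inner ℝ (B c) (ι d) := fun c d => by simp [ψ'']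
  have hder : ∀ z, HasFDerivAt ψ (ψ'' z) z := by
    intro z
    refine deriv_of_quad (C := ‖ι‖^2/(2*δ)) fun e => ?_
    rw [happ]
    refine (hmain z e).trans ?_
    rw [div_mul_eq_mul_div, ← mul_pow]
    gcongr
    exact ι.le_opNorm _
  have := second_derivative_symmetric hder (ψ''.hasFDerivAt (x := 0)) c d
  rwa [happ, happ] at this
end blow

end NL

namespace NL
open scoped Pointwise

section linalg
variable {G : Type*} [NormedAddCommGroup G] [NormedSpace ℝ G] [FiniteDimensional ℝ G]
variable {E : Type*} [NormedAddCommGroup E] [InnerProductSpace ℝ E] [FiniteDimensional ℝ E]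

/-- derivative of the ray map in chart coordinates -/
noncomputable def DF (L : (G × ℝ) ≃L[ℝ] E) (B : G →L[ℝ] E) (w : E) (t : ℝ) : (G × ℝ) →L[ℝ] (G × ℝ) :=
  (L.symm : E →L[ℝ] (G × ℝ)).comp
    (((L : (G × ℝ) →L[ℝ] E).comp (ContinuousLinearMap.inl ℝ G ℝ) + t • B).comp (ContinuousLinearMap.fst ℝ G ℝ)
      + (ContinuousLinearMap.snd ℝ G ℝ).smulRight w)

lemma DF_apply (L : (G × ℝ) ≃L[ℝ] E) (B : G →L[ℝ] E) (w : E) (t : ℝ) (z : G × ℝ) :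
    DF L B w t z = L.symm (L (z.1, 0) + t • B z.1 + z.2 • w) := by
  simp [DF]

lemma det_sym (N : E →ₗ[ℝ] E) (hN : N.IsSymmetric) : ∃ lam : Fin (Module.finrank ℝ E) → ℝ,
    (∀ i, ∃ z : E, z ≠ 0 ∧ N z = lam i • z) ∧
    ∀ t : ℝ, LinearMap.det (LinearMap.id + t • N) = ∏ i, (1 + t * lam i) := by
  refine ⟨hN.eigenvalues rfl, fun i => ⟨hN.eigenvectorBasis rfl i, ?_, ?_⟩, fun t => ?_⟩
  · intro h
    have := (hN.eigenvectorBasis rfl).orthonormal.1 i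
    rw [h, norm_zero] at this; norm_num at this
  · simpa using hN.apply_eigenvectorBasis rfl i
  · rw [← LinearMap.det_toMatrix (hN.eigenvectorBasis rfl).toBasis]
    have : LinearMap.toMatrix (hN.eigenvectorBasis rfl).toBasis (hN.eigenvectorBasis rfl).toBasis
        (LinearMap.id + t • N) = Matrix.diagonal (fun i => 1 + t * hN.eigenvalues rfl i) := by
      ext i j
      rw [LinearMap.toMatrix_apply]
      have h1 : (LinearMap.id + t • N : E →ₗ[ℝ] E) ((hN.eigenvectorBasis rfl).toBasis j)
          = (1 + t * hN.eigenvalues rfl j) • (hN.eigenvectorBasis rfl).toBasis j := by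
        have := hN.apply_eigenvectorBasis rfl j
        simp only [LinearMap.add_apply, LinearMap.id_apply, LinearMap.smul_apply,
          OrthonormalBasis.coe_toBasis]
        rw [this]
        simp only [RCLike.ofReal_real_eq_id, id]
        module
      rw [h1, map_smul, Module.Basis.repr_self, Finsupp.smul_single]
      by_cases hij : i = j
      · subst hij; simp
      · simp [hij, Finsupp.single_apply, Ne.symm hij]
    rw [this, Matrix.det_diagonal]

lemma det_form (L : (G × ℝ) ≃L[ℝ] E) (B : G →L[ℝ] E) (w : E) (hw : (L.symm w).2 ≠ 0)
    (hBw : ∀ c, inner ℝ (B c) w = 0)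
    (hBs : ∀ c d, inner ℝ (B c) (L (d, 0)) = inner ℝ (B d) (L (c, 0)))
    (S : Set ℝ) (hS : S.OrdConnected) (h0 : (0:ℝ) ∈ S)
    (hnd : ∀ t ∈ S, ∀ c (b : ℝ), L (c, 0) + t • B c + b • w = 0 → B c = 0) :
    ∃ (lam : Fin (Module.finrank ℝ E) → ℝ) (d0 : ℝ), 0 < d0 ∧ (∀ t ∈ S, ∀ i, 0 < 1 + t * lam i) ∧
      ∀ t ∈ S, |(DF L B w t).det| = d0 * ∏ i, (1 + t * lam i) := by
  -- the base map is a linear equivalence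
  let A : (G × ℝ) →ₗ[ℝ] E := (L : (G × ℝ) →ₗ[ℝ] E) ∘ₗ (DF L B w 0 : (G × ℝ) →ₗ[ℝ] (G × ℝ))
  have hA : ∀ z, A z = L (z.1, 0) + z.2 • w := fun z => by
    show L (DF L B w 0 z) = _
    rw [DF_apply]; simp
  have hinj : Function.Injective A := by
    rw [injective_iff_map_eq_zero]
    intro z hz
    rw [hA] at hz
    have h1 : (L.symm (L (z.1, 0) + z.2 • w)).2 = 0 := by rw [hz]; simp
    rw [map_add, map_smul, ContinuousLinearEquiv.symm_apply_apply] at h1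
    simp [hw] at h1
    rw [h1] at hz
    simp at hz
    exact Prod.ext hz h1
  have hfr : Module.finrank ℝ (G × ℝ) = Module.finrank ℝ E := L.toLinearEquiv.finrank_eq
  let Ae : (G × ℝ) ≃ₗ[ℝ] E := LinearEquiv.ofInjectiveOfFinrankEq A hinj hfr
  have hAe : ∀ z, Ae z = A z := fun z => rfl
  let N : E →ₗ[ℝ] E := (B : G →ₗ[ℝ] E) ∘ₗ (LinearMap.fst ℝ G ℝ) ∘ₗ (Ae.symm : E →ₗ[ℝ] (G × ℝ))
  have hN : ∀ z, N (A z) = B z.1 := fun z => by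
    show B (Ae.symm (Ae z)).1 = _
    rw [LinearEquiv.symm_apply_apply]
  have hsurj : ∀ x, ∃ z, A z = x := fun x => ⟨Ae.symm x, by rw [← hAe]; simp⟩
  have hNs : N.IsSymmetric := by
    intro x x'
    obtain ⟨z, rfl⟩ := hsurj x
    obtain ⟨z', rfl⟩ := hsurj x'
    have hw' : inner ℝ w (B z'.1) = 0 := by rw [real_inner_comm]; exact hBw _
    rw [hN, hN, hA z, hA z', inner_add_right, inner_add_left, inner_smul_right, inner_smul_left,
      hBw, hw', hBs, real_inner_comm (B z'.1)]
    simp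
  obtain ⟨lam, hl1, hl2⟩ := det_sym N hNs
  have hnz : ∀ t ∈ S, ∀ i, 1 + t * lam i ≠ 0 := by
    intro t ht i hi
    obtain ⟨x, hx, hNx⟩ := hl1 i
    obtain ⟨z, rfl⟩ := hsurj x
    have h1 : A z + t • N (A z) = 0 := by
      rw [hNx, smul_smul]
      have : A z + (t * lam i) • A z = (1 + t * lam i) • A z := by module
      rw [this, hi, zero_smul]
    have h2 : B z.1 = 0 := by
      apply hnd t ht z.1 z.2
      rw [hN, hA] at h1
      rw [← h1]; abel
    rw [hN, h2, smul_zero, add_zero] at h1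
    exact hx h1
  have hpos : ∀ t ∈ S, ∀ i, 0 < 1 + t * lam i := by
    intro t ht i
    by_contra hcon
    push Not at hcon
    have hlam : lam i ≠ 0 := by
      intro h; rw [h] at hcon; simp at hcon; linarith
    have hmem : -(lam i)⁻¹ ∈ S := by
      rcases lt_or_gt_of_ne hlam with h | h
      · have h1 : 0 < -(lam i)⁻¹ := by simpa using h
        refine hS.out h0 ht ⟨h1.le, ?_⟩
        have h2 : -(lam i)⁻¹ * (-lam i) = 1 := by rw [neg_mul_neg, inv_mul_cancel₀ hlam]
        nlinarith
      · have h1 : 0 < (lam i)⁻¹ := by simpa using h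
        refine hS.out ht h0 ⟨?_, by linarith⟩
        have h2 : (lam i)⁻¹ * (lam i) = 1 := inv_mul_cancel₀ hlam
        nlinarith
    apply hnz _ hmem i
    rw [neg_mul, inv_mul_cancel₀ hlam]; ring
  refine ⟨lam, |(DF L B w 0).det|, ?_, ?_, ?_⟩
  · rw [abs_pos]
    have : Function.Injective (DF L B w 0 : (G × ℝ) →ₗ[ℝ] (G × ℝ)) := fun a b hab =>
      hinj (by show L _ = L _; exact congrArg L hab)
    have hu := LinearMap.isUnit_iff_ker_eq_bot (DF L B w 0 : (G × ℝ) →ₗ[ℝ] (G × ℝ)) |>.2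
      (LinearMap.ker_eq_bot.2 this)
    exact (LinearMap.isUnit_det _ hu).ne_zero
  · exact hpos
  · intro t ht
    have hfac : (DF L B w t : (G × ℝ) →ₗ[ℝ] (G × ℝ)) =
        ((L.symm.toLinearEquiv : E →ₗ[ℝ] (G × ℝ)) ∘ₗ (LinearMap.id + t • N) ∘ₗ (L.symm.toLinearEquiv.symm : (G × ℝ) →ₗ[ℝ] E))
          ∘ₗ (DF L B w 0 : (G × ℝ) →ₗ[ℝ] (G × ℝ)) := by
      apply LinearMap.ext
      intro z
      show DF L B w t z = L.symm (A z + t • N (A z))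
      rw [DF_apply, hN, hA]
      congr 1
      abel
    have hdet : (DF L B w t).det = (∏ i, (1 + t * lam i)) * (DF L B w 0).det := by
      show LinearMap.det (DF L B w t : (G × ℝ) →ₗ[ℝ] (G × ℝ)) = _ * LinearMap.det (DF L B w 0 : (G × ℝ) →ₗ[ℝ] (G × ℝ))
      rw [hfac, LinearMap.det_comp, LinearMap.det_conj, hl2]
    rw [hdet, abs_mul, abs_of_nonneg (Finset.prod_nonneg fun i _ => (hpos t ht i).le), mul_comm]
end linalg

end NL

namespace NL
open scoped Pointwise
section needle
open Filter Topology
variable {E : Type*} [NormedAddCommGroup E] [InnerProductSpace ℝ E]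

lemma psi_props {κ : ℝ} {Ω : Set E} (ho : IsOpen Ω) {ρ : E → ℝ}
    (hρ : ContDiffOn ℝ (⊤ : ℕ∞) ρ Ω)
    (hHess : ∀ x ∈ Ω, ∀ v : E, κ * ‖v‖ ^ 2 ≤ iteratedFDerivWithin ℝ 2 ρ Ω x ![v, v])
    {k : ℕ} (lam : Fin k → ℝ) {C : ℝ} (hC : 0 < C) {A : Set ℝ} (hA : IsOpen A) {x e : E}
    (he : ‖e‖ = 1) (hAΩ : ∀ t ∈ A, x + t • e ∈ Ω) (hpos : ∀ t ∈ A, ∀ i, 0 < 1 + t * lam i) :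
    ∃ Ψ : ℝ → ℝ, ContDiffOn ℝ (⊤ : ℕ∞) Ψ A ∧ (∀ t ∈ A, κ ≤ deriv (deriv Ψ) t) ∧
      ∀ t ∈ A, Real.exp (-Ψ t) = Real.exp (-ρ (x + t • e)) * (C * ∏ i, (1 + t * lam i)) := by
  let l : ℝ → E := fun t => x + t • e
  have hl : ∀ t, HasDerivAt l e t := fun t => by
    have := ((hasDerivAt_id' t).smul_const e).const_add x
    rwa [one_smul] at this
  have hlc : ContDiff ℝ (⊤ : ℕ∞) l := by fun_prop
  let Ψ : ℝ → ℝ := fun t => ρ (l t) - Real.log C - ∑ i, Real.log (1 + t * lam i)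
  have hρat : ∀ z ∈ Ω, ContDiffAt ℝ (⊤ : ℕ∞) ρ z := fun z hz => hρ.contDiffAt (ho.mem_nhds hz)
  have hd1 : ∀ t ∈ A, HasDerivAt Ψ (fderiv ℝ ρ (l t) e - ∑ i, lam i / (1 + t * lam i)) t := by
    intro t ht
    have h1 : HasDerivAt (fun t => ρ (l t)) (fderiv ℝ ρ (l t) e) t :=
      ((hρat _ (hAΩ t ht)).differentiableAt (by simp)).hasFDerivAt.comp_hasDerivAt t (hl t)
    have h2 : HasDerivAt (fun t => ∑ i, Real.log (1 + t * lam i)) (∑ i, lam i / (1 + t * lam i)) t := by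
      refine HasDerivAt.fun_sum fun i _ => ?_
      have : HasDerivAt (fun t => 1 + t * lam i) (lam i) t := by
        simpa using ((hasDerivAt_id t).mul_const (lam i)).const_add 1
      exact this.log (hpos t ht i).ne'
    exact (h1.sub_const _).sub h2
  refine ⟨Ψ, ?_, ?_, ?_⟩
  · have h1 : ContDiffOn ℝ (⊤ : ℕ∞) (fun t => ρ (l t)) A := hρ.comp hlc.contDiffOn hAΩ
    refine (h1.sub contDiffOn_const).sub ?_
    refine ContDiffOn.sum fun i _ => ?_
    refine ContDiffOn.log (by fun_prop) fun t ht => (hpos t ht i).ne'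
  · intro t ht
    have hev : deriv Ψ =ᶠ[𝓝 t] fun t => fderiv ℝ ρ (l t) e - ∑ i, lam i / (1 + t * lam i) := by
      filter_upwards [hA.mem_nhds ht] with s hs using (hd1 s hs).deriv
    rw [hev.deriv_eq]
    have h1 : HasDerivAt (fun t => fderiv ℝ ρ (l t) e) (fderiv ℝ (fderiv ℝ ρ) (l t) e e) t := by
      have hc : ContDiffAt ℝ 1 (fderiv ℝ ρ) (l t) :=
        (hρat _ (hAΩ t ht)).fderiv_right (m := 1) (by norm_cast)
      have h3 : HasDerivAt (fun t => fderiv ℝ ρ (l t)) (fderiv ℝ (fderiv ℝ ρ) (l t) e) t :=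
        (hc.differentiableAt (by simp)).hasFDerivAt.comp_hasDerivAt t (hl t)
      simpa using h3.clm_apply (hasDerivAt_const t e)
    have h2 : HasDerivAt (fun t => ∑ i, lam i / (1 + t * lam i))
        (∑ i, -(lam i^2 / (1 + t * lam i)^2)) t := by
      refine HasDerivAt.fun_sum fun i _ => ?_
      have h4 : HasDerivAt (fun t => 1 + t * lam i) (lam i) t := by
        simpa using ((hasDerivAt_id t).mul_const (lam i)).const_add 1
      have h5 := (hasDerivAt_const t (lam i)).div h4 (hpos t ht i).ne'
      have h8 : (0 * (1 + t * lam i) - lam i * lam i) / (1 + t * lam i)^2 = -(lam i^2 / (1 + t * lam i)^2) := by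
        ring
      rw [h8] at h5
      exact h5
    rw [(h1.fun_sub h2).deriv]
    have h6 := hHess _ (hAΩ t ht) e
    rw [he, iteratedFDerivWithin_of_isOpen 2 ho (hAΩ t ht), iteratedFDeriv_two_apply] at h6
    have h7 : 0 ≤ ∑ i, (lam i^2 / (1 + t * lam i)^2) := Finset.sum_nonneg fun i _ => by positivity
    rw [Finset.sum_neg_distrib]
    simp at h6
    have : l t = x + t • e := rfl
    rw [this]
    linarith
  · intro t ht
    have h1 : Real.exp (∑ i, Real.log (1 + t * lam i)) = ∏ i, (1 + t * lam i) := by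
      rw [Real.exp_sum]
      exact Finset.prod_congr rfl fun i _ => Real.exp_log (hpos t ht i)
    have : -Ψ t = -ρ (x + t • e) + (Real.log C + ∑ i, Real.log (1 + t * lam i)) := by
      simp only [Ψ, l]; ring
    rw [this, Real.exp_add, Real.exp_add, Real.exp_log hC, h1]
end needle
end NL

set_option linter.unusedSectionVars false
namespace NL
open scoped Pointwise
section chart
open Filter Topology
variable {G : Type*} [NormedAddCommGroup G] [NormedSpace ℝ G] [FiniteDimensional ℝ G]
  [MeasurableSpace G] [BorelSpace G]
variable {E : Type*} [NormedAddCommGroup E] [InnerProductSpace ℝ E] [FiniteDimensional ℝ E]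
  [MeasurableSpace E] [BorelSpace E]

/-- base points of a chart -/
def Cc (u : E → ℝ) (Ω : Set E) (L : (G × ℝ) ≃L[ℝ] E) (r δ : ℝ) : Set G :=
  {y | L (y, r) ∈ Ω ∧ L (y, r) ∈ R u δ δ ∧ (L.symm (vf u (L (y, r)))).2 ≠ 0}

/-- saturation of a set of base points -/
def sat (u : E → ℝ) (Ω : Set E) (L : (G × ℝ) ≃L[ℝ] E) (r : ℝ) (P : Set G) : Set E :=
  {z | z ∈ Ω ∧ ∃ y ∈ P, z ∈ O u (L (y, r))}

def D0 (u : E → ℝ) (Ω : Set E) (L : (G × ℝ) ≃L[ℝ] E) (r δ : ℝ) : Set (G × ℝ) :=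
  {x | x.1 ∈ Cc u Ω L r δ ∧ x.2 ∈ T u (L (x.1, r)) ∧
    L (x.1, r) + x.2 • vf u (L (x.1, r)) ∈ Ω}

def Fw (L : (G × ℝ) ≃L[ℝ] E) (r : ℝ) (w : G → E) (x : G × ℝ) : E := L (x.1, r) + x.2 • w x.1

lemma T_rat {u : E → ℝ} (hu : Lip1 u) {x : E} {t : ℝ} : t ∈ T u x ↔
    ∃ a b : ℚ, (0:ℝ) < a ∧ (0:ℝ) < b ∧ -(a:ℝ) < t ∧ t < b ∧ x ∈ R u a b := by
  constructor
  · rintro ⟨a, b, ha, hb, h1, h2, hx⟩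
    obtain ⟨a', ha1, ha2⟩ := exists_rat_btwn (show max 0 (-t) < a from max_lt ha (by linarith))
    obtain ⟨b', hb1, hb2⟩ := exists_rat_btwn (show max 0 t < b from max_lt hb h2)
    obtain ⟨h3, h4⟩ := max_lt_iff.1 ha1
    obtain ⟨h5, h6⟩ := max_lt_iff.1 hb1
    exact ⟨a', b', h3, h5, by linarith, h6, R_mono hu h3.le ha2.le h5.le hb2.le hx⟩
  · rintro ⟨a, b, ha, hb, h1, h2, hx⟩
    exact ⟨a, b, ha, hb, h1, h2, hx⟩

variable {u : E → ℝ} {Ω : Set E} {L : (G × ℝ) ≃L[ℝ] E} {r δ : ℝ} {w : G → E} {K : NNReal}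

lemma exists_w (u : E → ℝ) (hu : Lip1 u) (L : (G × ℝ) ≃L[ℝ] E) (r : ℝ) {δ : ℝ} (hδ : 0 < δ) :
    ∃ (w : G → E) (K : NNReal), LipschitzWith K w ∧
      ∀ y, L (y, r) ∈ R u δ δ → w y = vf u (L (y, r)) := by
  have h1 : LipschitzWith ‖(L : (G × ℝ) →L[ℝ] E)‖₊ (fun y : G => L (y, r)) := by
    have := (L : (G × ℝ) →L[ℝ] E).lipschitz.comp (LipschitzWith.prodMk_right r : LipschitzWith 1 (fun y : G => (y, r)))
    rw [mul_one] at this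
    exact this
  have h2 := (vf_lipOn hu hδ).comp (h1.lipschitzOnWith (s := {y | L (y, r) ∈ R u δ δ})) (fun y hy => hy)
  obtain ⟨w, hw, he⟩ := h2.extend_finite_dimension
  exact ⟨w, _, hw, fun y hy => (he hy).symm⟩

lemma Cc_meas (hu : Lip1 u) (hΩ : IsOpen Ω) (hw : LipschitzWith K w)
    (hwe : ∀ y, L (y, r) ∈ R u δ δ → w y = vf u (L (y, r))) : MeasurableSet (Cc u Ω L r δ) := by
  have h1 : Cc u Ω L r δ = (fun y => L (y, r)) ⁻¹' (Ω ∩ R u δ δ) ∩ {y | (L.symm (w y)).2 ≠ 0} := by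
    ext y
    constructor
    · rintro ⟨h1, h2, h3⟩
      exact ⟨⟨h1, h2⟩, by show (L.symm (w y)).2 ≠ 0; rw [hwe y h2]; exact h3⟩
    · rintro ⟨⟨h1, h2⟩, h3⟩
      refine ⟨h1, h2, ?_⟩
      rw [← hwe y h2]; exact h3
  rw [h1]
  have hwc := hw.continuous
  refine MeasurableSet.inter ?_ ?_
  · exact (show Continuous fun y : G => L (y, r) by fun_prop).measurable
      (hΩ.measurableSet.inter (R_closed hu δ δ).measurableSet)
  · exact (isOpen_ne_fun (by fun_prop) continuous_const).measurableSet

lemma Fw_cont (hw : LipschitzWith K w) : Continuous (Fw L r w) := by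
  have hwc := hw.continuous
  unfold Fw
  fun_prop

lemma D0_meas (hu : Lip1 u) (hΩ : IsOpen Ω) (hw : LipschitzWith K w)
    (hwe : ∀ y, L (y, r) ∈ R u δ δ → w y = vf u (L (y, r))) : MeasurableSet (D0 u Ω L r δ) := by
  have h1 : D0 u Ω L r δ = (Prod.fst ⁻¹' Cc u Ω L r δ) ∩ (Fw L r w ⁻¹' Ω) ∩
      ⋃ a : ℚ, ⋃ b : ℚ, {x : G × ℝ | (0:ℝ) < a ∧ (0:ℝ) < b ∧ -(a:ℝ) < x.2 ∧ x.2 < b ∧ L (x.1, r) ∈ R u a b} := by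
    ext ⟨y, t⟩
    simp only [D0, Set.mem_inter_iff, Set.mem_preimage, Set.mem_iUnion, Set.mem_ofPred_eq, T_rat hu, Fw]
    constructor
    · rintro ⟨h1, h2, h3⟩
      rw [hwe y h1.2.1]
      exact ⟨⟨h1, h3⟩, h2⟩
    · rintro ⟨⟨h1, h3⟩, h2⟩
      rw [hwe y h1.2.1] at h3
      exact ⟨h1, h2, h3⟩
  rw [h1]
  refine ((measurable_fst (Cc_meas hu hΩ hw hwe)).inter ((Fw_cont hw).measurable hΩ.measurableSet)).inter ?_
  refine MeasurableSet.iUnion fun a => MeasurableSet.iUnion fun b => ?_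
  by_cases ha : (0:ℝ) < a
  swap
  · simp [ha]
  by_cases hb : (0:ℝ) < b
  swap
  · simp [hb]
  simp only [ha, hb, true_and]
  refine (measurableSet_lt measurable_const measurable_snd).inter
    ((measurableSet_lt measurable_snd measurable_const).inter ?_)
  exact (show Continuous fun x : G × ℝ => L (x.1, r) by fun_prop).measurable (R_closed hu a b).measurableSet

lemma ell_eq (y : G) (t : ℝ) (e : E) : (L.symm (L (y, r) + t • e)).2 = r + t * (L.symm e).2 := by
  simp

lemma uniq_base (hu : Lip1 u) {y y' : G} (hy : y ∈ Cc u Ω L r δ) {z : E}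
    (h : z ∈ O u (L (y, r))) (h' : z ∈ O u (L (y', r))) : y = y' := by
  have h1 := (O_eq hu h).2.1
  have h2 := (O_eq hu h').2.1
  obtain ⟨t, ht, rfl⟩ := h
  obtain ⟨t', ht', he⟩ := h'
  have hv : vf u (L (y, r)) = vf u (L (y', r)) := h1.symm.trans h2
  simp only at he
  rw [← hv] at he
  have h3 := congrArg (fun z => (L.symm z).2) he
  simp only [ell_eq] at h3
  have h4 : t' = t := by
    have := mul_right_cancel₀ hy.2.2 (add_left_cancel h3)
    exact this
  rw [h4] at he
  have h5 := L.injective (add_right_cancel he)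
  exact (congrArg Prod.fst h5).symm

lemma Fw_inj (hu : Lip1 u) (hwe : ∀ y, L (y, r) ∈ R u δ δ → w y = vf u (L (y, r))) :
    Set.InjOn (Fw L r w) (D0 u Ω L r δ) := by
  rintro ⟨y, t⟩ ⟨h1, h2, h3⟩ ⟨y', t'⟩ ⟨h1', h2', h3'⟩ he
  simp only [Fw] at *
  rw [hwe _ h1.2.1, hwe _ h1'.2.1] at he
  have : y = y' := uniq_base hu h1 ⟨t, h2, rfl⟩ ⟨t', h2', he.symm⟩
  subst this
  have h5 : t • vf u (L (y, r)) = t' • vf u (L (y, r)) := add_left_cancel he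
  have h6 : vf u (L (y, r)) ≠ 0 := by
    intro h; apply h1.2.2; rw [h]; simp
  rw [smul_left_injective ℝ h6 h5]

lemma Fw_image (hwe : ∀ y, L (y, r) ∈ R u δ δ → w y = vf u (L (y, r))) {P : Set G}
    (hP : P ⊆ Cc u Ω L r δ) :
    Fw L r w '' (D0 u Ω L r δ ∩ Prod.fst ⁻¹' P) = sat u Ω L r P := by
  ext z
  constructor
  · rintro ⟨⟨y, t⟩, ⟨⟨h1, h2, h3⟩, h4⟩, rfl⟩
    simp only [Fw] at *
    rw [hwe _ h1.2.1]
    exact ⟨h3, y, h4, t, h2, rfl⟩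
  · rintro ⟨h1, y, hy, t, ht, rfl⟩
    refine ⟨⟨y, t⟩, ⟨⟨hP hy, ht, h1⟩, hy⟩, ?_⟩
    simp only [Fw]
    rw [hwe _ (hP hy).2.1]

lemma sat_meas (hu : Lip1 u) (hΩ : IsOpen Ω) (hδ : 0 < δ) {P : Set G}
    (hP : P ⊆ Cc u Ω L r δ) (hPm : MeasurableSet P) : MeasurableSet (sat u Ω L r P) := by
  obtain ⟨w, K, hw, hwe⟩ := exists_w u hu L r hδ
  rw [← Fw_image hwe hP]
  exact ((D0_meas hu hΩ hw hwe).inter (measurable_fst hPm)).image_of_continuousOn_injOn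
    (Fw_cont hw).continuousOn ((Fw_inj hu hwe).mono Set.inter_subset_left)

lemma Fw_deriv {y : G} {t : ℝ} (hd : DifferentiableAt ℝ w y) :
    HasFDerivAt (fun x => L.symm (Fw L r w x)) (DF L (fderiv ℝ w y) (w y) t) (y, t) := by
  have h1 : HasFDerivAt (fun x : G × ℝ => L (x.1, r))
      (((L : (G × ℝ) →L[ℝ] E).comp (ContinuousLinearMap.inl ℝ G ℝ)).comp (ContinuousLinearMap.fst ℝ G ℝ)) (y, t) := by
    have h2 : (fun x : G × ℝ => L (x.1, r)) = fun x => (((L : (G × ℝ) →L[ℝ] E).comp (ContinuousLinearMap.inl ℝ G ℝ)).comp (ContinuousLinearMap.fst ℝ G ℝ)) x + L (0, r) := by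
      funext x
      simp [← map_add]
    rw [h2]
    exact (ContinuousLinearMap.hasFDerivAt _).add_const _
  have h3 : HasFDerivAt (fun x : G × ℝ => w x.1) ((fderiv ℝ w y).comp (ContinuousLinearMap.fst ℝ G ℝ)) (y, t) :=
    HasFDerivAt.comp (y, t) (f := Prod.fst) (g := w) hd.hasFDerivAt hasFDerivAt_fst
  have h4 := (hasFDerivAt_snd (𝕜 := ℝ) (E := G) (F := ℝ) (p := (y, t))).smul h3
  have h5 := (L.symm : E →L[ℝ] (G × ℝ)).hasFDerivAt.comp (y, t) (h1.add h4)
  have h6 : DF L (fderiv ℝ w y) (w y) t = (L.symm : E →L[ℝ] (G × ℝ)).comp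
      ((((L : (G × ℝ) →L[ℝ] E).comp (ContinuousLinearMap.inl ℝ G ℝ)).comp (ContinuousLinearMap.fst ℝ G ℝ)) +
      (t • (fderiv ℝ w y).comp (ContinuousLinearMap.fst ℝ G ℝ) +
        (ContinuousLinearMap.snd ℝ G ℝ).smulRight (w y))) := by
    refine ContinuousLinearMap.ext fun z => ?_
    rw [DF_apply]
    simp [add_assoc]
  rw [h6]
  exact h5

lemma Fw_null (lamG : Measure G) [lamG.IsAddHaarMeasure] (hw : LipschitzWith K w)
    {s : Set (G × ℝ)} (hs : ∀ x ∈ s, ‖w x.1‖ ≤ 1) (h0 : (lamG.prod volume) s = 0) :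
    (lamG.prod volume) ((fun x => L.symm (Fw L r w x)) '' s) = 0 := by
  have hlip : ∀ k : ℕ, LipschitzOnWith (‖(L : (G × ℝ) →L[ℝ] E)‖₊ + (k * K + 1)) (Fw L r w)
      (s ∩ {x | |x.2| ≤ k}) := by
    intro k
    refine LipschitzOnWith.of_dist_le_mul ?_
    rintro ⟨y, t⟩ ⟨h1, h2⟩ ⟨y', t'⟩ ⟨h1', h2'⟩
    have e1 : Fw L r w (y, t) - Fw L r w (y', t') =
        L ((y, r) - (y', r)) + (t • (w y - w y') + (t - t') • w y') := by
      simp only [Fw, map_sub]; module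
    have e2 : ‖(y, r) - (y', r)‖ ≤ dist (y, t) (y', t') := by
      rw [dist_eq_norm]; simp [Prod.norm_def]
    have e3 : ‖w y - w y'‖ ≤ K * dist (y, t) (y', t') := by
      rw [← dist_eq_norm]
      refine (hw.dist_le_mul y y').trans ?_
      gcongr
      rw [Prod.dist_eq]; exact le_max_left _ _
    have e4 : |t - t'| ≤ dist (y, t) (y', t') := by
      rw [Prod.dist_eq]; exact le_max_right _ _
    have e5 := (L : (G × ℝ) →L[ℝ] E).le_opNorm ((y, r) - (y', r))
    rw [dist_eq_norm, e1]
    refine (norm_add_le _ _).trans ?_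
    have e6 : ‖t • (w y - w y') + (t - t') • w y'‖ ≤ k * (K * dist (y, t) (y', t')) + dist (y, t) (y', t') * 1 := by
      refine (norm_add_le _ _).trans ?_
      rw [norm_smul, norm_smul]
      have h3 : ‖w y'‖ ≤ 1 := hs _ h1'
      have h4 : ‖t‖ ≤ k := h2
      have h5 : ‖t - t'‖ ≤ dist (y, t) (y', t') := e4
      gcongr
    have e7 : ‖(L : (G × ℝ) →L[ℝ] E)‖ * ‖(y, r) - (y', r)‖ ≤ ‖(L : (G × ℝ) →L[ℝ] E)‖ * dist (y, t) (y', t') := by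
      gcongr
    push_cast
    have e8 : ‖L ((y, r) - (y', r))‖ = ‖(L : (G × ℝ) →L[ℝ] E) ((y, r) - (y', r))‖ := rfl
    rw [e8]
    linarith
  refine lip_null (lamG.prod volume) (fun k => ‖(L.symm : E →L[ℝ] (G × ℝ))‖₊ * (‖(L : (G × ℝ) →L[ℝ] E)‖₊ + (k * K + 1)))
    (fun k => {x | |x.2| ≤ k}) (fun k => ?_) ?_ h0
  · exact (L.symm : E →L[ℝ] (G × ℝ)).lipschitz.comp_lipschitzOnWith (hlip k)
  · intro x hx
    obtain ⟨k, hk⟩ := exists_nat_ge |x.2|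
    exact Set.mem_iUnion.2 ⟨k, hk⟩
end chart
end NL

set_option linter.unusedSectionVars false
namespace NL
open scoped Pointwise
section chart2
open Filter Topology
variable {G : Type*} [NormedAddCommGroup G] [NormedSpace ℝ G] [FiniteDimensional ℝ G]
  [MeasurableSpace G] [BorelSpace G] (lamG : Measure G) [lamG.IsAddHaarMeasure]
variable {E : Type*} [NormedAddCommGroup E] [InnerProductSpace ℝ E] [FiniteDimensional ℝ E]
  [MeasurableSpace E] [BorelSpace E] (vol : Measure E) [vol.IsAddHaarMeasure]
variable {u : E → ℝ} {Ω : Set E} {L : (G × ℝ) ≃L[ℝ] E} {r δ : ℝ} {w : G → E} {K : NNReal}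

def DetGood (u : E → ℝ) (L : (G × ℝ) ≃L[ℝ] E) (r : ℝ) (w : G → E) (y : G) : Prop :=
  DifferentiableAt ℝ w y ∧ ∃ (lam : Fin (Module.finrank ℝ E) → ℝ) (d0 : ℝ), 0 < d0 ∧
    (∀ t ∈ T u (L (y, r)), ∀ i, 0 < 1 + t * lam i) ∧
    ∀ t ∈ T u (L (y, r)), |(DF L (fderiv ℝ w y) (w y) t).det| = d0 * ∏ i, (1 + t * lam i)

lemma det_ae (hu : Lip1 u) (hδ : 0 < δ) (hw : LipschitzWith K w)
    (hwe : ∀ y, L (y, r) ∈ R u δ δ → w y = vf u (L (y, r))) :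
    ∀ᵐ y ∂lamG, y ∈ Cc u Ω L r δ → DetGood u L r w y := by
  let M : ℝ → ℝ → Set G := fun a b => {y | L (y, r) ∈ R u a b ∩ R u δ δ}
  have hM : ∀ a b, MeasurableSet (M a b) := fun a b =>
    (show Continuous fun y : G => L (y, r) by fun_prop).measurable
      ((R_closed hu a b).measurableSet.inter (R_closed hu δ δ).measurableSet)
  have h1 : ∀ᵐ y ∂lamG, ∀ a b : ℚ, y ∈ M a b → Dens (M a b) y := by
    rw [ae_all_iff]; intro a
    rw [ae_all_iff]; intro b
    exact dens_ae lamG (hM a b)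
  filter_upwards [h1, dens_ae lamG (hM δ δ), hw.ae_differentiableAt] with y h1 h2 h3 hy
  refine ⟨h3, ?_⟩
  let ι : G →L[ℝ] E := (L : (G × ℝ) →L[ℝ] E).comp (ContinuousLinearMap.inl ℝ G ℝ)
  have hι : ∀ c, ι c = L (c, 0) := fun c => rfl
  have hp : ∀ z, L (0, r) + ι z = L (z, r) := fun z => by rw [hι, ← map_add]; simp
  have hseg : ∀ a b : ℝ, 0 < a → 0 < b → ∀ z ∈ M a b, Seg u (L (0, r) + ι z) (w z) a b := by
    intro a b ha hb z hz
    rw [hp, hwe z hz.2]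
    exact vf_seg hu ha hb hz.1
  have hyM : y ∈ M δ δ := ⟨hy.2.1, hy.2.1⟩
  have hw1 : w y = vf u (L (y, r)) := hwe y hy.2.1
  refine det_form L (fderiv ℝ w y) (w y) (by rw [hw1]; exact hy.2.2) ?_ ?_ (T u (L (y, r)))
    (T_ord hu _) (zero_mem_T ⟨δ, hδ, hy.2.1⟩) ?_
  · exact blow_a hyM h3.hasFDerivAt (h2 hyM) fun z hz => (hseg δ δ hδ hδ z hz).1
  · exact blow_b hu hδ hyM h3.hasFDerivAt (h2 hyM) (hseg δ δ hδ hδ)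
  · intro t ht c b h0
    obtain ⟨a, b', ha, hb, hat, htb, hx⟩ := (T_rat hu).1 ht
    have hy' : y ∈ M a b' := ⟨hx, hy.2.1⟩
    exact blow_c hu hy' h3.hasFDerivAt (h1 a b' hy') hat htb ha hb (hseg a b' ha hb) c b h0

/-- density along the rays -/
noncomputable def rd (u : E → ℝ) (Ω : Set E) (L : (G × ℝ) ≃L[ℝ] E) (r δ : ℝ) (w : G → E)
    (h : E → ℝ≥0∞) (c : ℝ≥0∞) : G × ℝ → ℝ≥0∞ :=
  fun x => c * (D0 u Ω L r δ ∩ Prod.fst ⁻¹' {y | DifferentiableAt ℝ w y}).indicator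
    (fun x => ENNReal.ofReal |(DF L (fderiv ℝ w x.1) (w x.1) x.2).det| * h (Fw L r w x)) x

lemma rd_meas (hu : Lip1 u) (hΩ : IsOpen Ω) (hw : LipschitzWith K w)
    (hwe : ∀ y, L (y, r) ∈ R u δ δ → w y = vf u (L (y, r))) {h : E → ℝ≥0∞} (hh : Measurable h)
    (c : ℝ≥0∞) : Measurable (rd u Ω L r δ w h c) := by
  have hcont : Continuous (fun q : (G →L[ℝ] E) × E × ℝ => |(DF L q.1 q.2.1 q.2.2).det|) := by
    refine (ContinuousLinearMap.continuous_det.comp ?_).abs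
    unfold DF
    refine continuous_const.clm_comp (Continuous.add (Continuous.clm_comp ?_ continuous_const) ?_)
    · fun_prop
    · exact (ContinuousLinearMap.smulRightL ℝ (G × ℝ) E (ContinuousLinearMap.snd ℝ G ℝ)).continuous.comp
        (continuous_fst.comp continuous_snd)
  have hm : Measurable (fun x : G × ℝ => (fderiv ℝ w x.1, w x.1, x.2)) := by
    refine ((measurable_fderiv ℝ w).comp measurable_fst).prodMk
      ((hw.continuous.measurable.comp measurable_fst).prodMk measurable_snd)
  refine Measurable.const_mul (Measurable.indicator ?_ ?_) c
  · exact (ENNReal.measurable_ofReal.comp (hcont.measurable.comp hm)).mul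
      (hh.comp (Fw_cont hw).measurable)
  · exact (D0_meas hu hΩ hw hwe).inter (measurable_fst (measurableSet_of_differentiableAt ℝ w))

noncomputable def eta (u : E → ℝ) (Ω : Set E) (L : (G × ℝ) ≃L[ℝ] E) (r δ : ℝ) (w : G → E)
    (h : E → ℝ≥0∞) (c : ℝ≥0∞) (y : G) : Measure E :=
  Measure.map (fun t => Fw L r w (y, t)) (volume.withDensity fun t => rd u Ω L r δ w h c (y, t))

lemma eta_apply (hu : Lip1 u) (hΩ : IsOpen Ω) (hw : LipschitzWith K w)
    (hwe : ∀ y, L (y, r) ∈ R u δ δ → w y = vf u (L (y, r))) {h : E → ℝ≥0∞} (hh : Measurable h)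
    (c : ℝ≥0∞) (y : G) {B : Set E} (hB : MeasurableSet B) :
    eta u Ω L r δ w h c y B = ∫⁻ t, (Fw L r w ⁻¹' B).indicator (rd u Ω L r δ w h c) (y, t) := by
  have hm : Measurable (fun t => Fw L r w (y, t)) := ((Fw_cont hw).comp (by fun_prop)).measurable
  rw [eta, Measure.map_apply hm hB, withDensity_apply _ (hm hB), ← lintegral_indicator (hm hB)]
  rfl

lemma eta_meas (hu : Lip1 u) (hΩ : IsOpen Ω) (hw : LipschitzWith K w)
    (hwe : ∀ y, L (y, r) ∈ R u δ δ → w y = vf u (L (y, r))) {h : E → ℝ≥0∞} (hh : Measurable h)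
    (c : ℝ≥0∞) : Measurable (eta u Ω L r δ w h c) := by
  refine Measure.measurable_of_measurable_coe _ fun B hB => ?_
  simp_rw [eta_apply hu hΩ hw hwe hh c _ hB]
  exact ((rd_meas hu hΩ hw hwe hh c).indicator ((Fw_cont hw).measurable hB)).lintegral_prod_right'

lemma cov (hu : Lip1 u) (hΩ : IsOpen Ω) (hδ : 0 < δ) (hw : LipschitzWith K w)
    (hwe : ∀ y, L (y, r) ∈ R u δ δ → w y = vf u (L (y, r))) {h : E → ℝ≥0∞} (hh : Measurable h)
    {c : ℝ≥0∞} (hcne : c ≠ ⊤) (hc : vol = c • Measure.map L (lamG.prod volume))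
    {P : Set G} (hPm : MeasurableSet P) (hP : P ⊆ Cc u Ω L r δ) {B : Set E} (hB : MeasurableSet B) :
    (vol.withDensity h) (B ∩ sat u Ω L r P) = ∫⁻ y in P, eta u Ω L r δ w h c y B ∂lamG := by
  have hsm := sat_meas (L := L) hu hΩ hδ hP hPm
  let f : G × ℝ → G × ℝ := fun x => L.symm (Fw L r w x)
  have hLf : ∀ x, L (f x) = Fw L r w x := fun x => by simp [f]
  set Dg : Set (G × ℝ) := Prod.fst ⁻¹' {y | DifferentiableAt ℝ w y} with hDg
  have hDgm : MeasurableSet Dg := measurable_fst (measurableSet_of_differentiableAt ℝ w)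
  let DP := D0 u Ω L r δ ∩ Prod.fst ⁻¹' P
  have hDP : MeasurableSet DP := (D0_meas hu hΩ hw hwe).inter (measurable_fst hPm)
  have himg : L ⁻¹' (sat u Ω L r P) = f '' DP := by
    rw [← Fw_image hwe hP]
    ext x
    constructor
    · rintro ⟨z, hz, hzx⟩
      exact ⟨z, hz, by simp only [f]; rw [hzx]; simp⟩
    · rintro ⟨z, hz, rfl⟩
      exact ⟨z, hz, (hLf z).symm⟩
  have hnull : (lamG.prod volume) (f '' (DP ∩ Dgᶜ)) = 0 := by
    refine Fw_null lamG hw ?_ ?_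
    · rintro ⟨y, t⟩ ⟨⟨h1, -⟩, -⟩
      have h2 : L (y, r) ∈ R u δ δ := h1.1.2.1
      simp only
      rw [hwe y h2]
      exact (vf_norm ⟨δ, hδ, h2⟩).le
    · refine measure_mono_null Set.inter_subset_right ?_
      have h3 : lamG {y | DifferentiableAt ℝ w y}ᶜ = 0 := hw.ae_differentiableAt
      have h4 : Dgᶜ = {y | DifferentiableAt ℝ w y}ᶜ ×ˢ (Set.univ : Set ℝ) := by
        ext ⟨y, t⟩; simp [hDg]
      rw [h4, Measure.prod_prod, h3, zero_mul]
  have hae : (f '' DP : Set (G × ℝ)) =ᵐ[lamG.prod volume] f '' (DP ∩ Dg) := by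
    have h5 : f '' DP = f '' (DP ∩ Dg) ∪ f '' (DP ∩ Dgᶜ) := by
      rw [← Set.image_union, Set.inter_union_compl]
    rw [h5]
    exact union_ae_eq_left_of_ae_eq_empty (ae_eq_empty.2 hnull)
  have hLm : Measurable (L : G × ℝ → E) := L.continuous.measurable
  have hinj : Set.InjOn f (DP ∩ Dg) := by
    intro a ha b hb hab
    exact Fw_inj hu hwe ha.1.1 hb.1.1 (L.symm.injective hab)
  have hcov := lintegral_image_eq_lintegral_abs_det_fderiv_mul (lamG.prod volume) (hDP.inter hDgm)
    (f := f) (f' := fun x => DF L (fderiv ℝ w x.1) (w x.1) x.2)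
    (fun x hx => (Fw_deriv (t := x.2) hx.2).hasFDerivWithinAt) hinj (fun x => B.indicator h (L x))
  rw [withDensity_apply _ (hB.inter hsm), ← setLIntegral_indicator hB]
  have hBh : Measurable (B.indicator h) := hh.indicator hB
  conv_lhs => rw [hc]
  rw [Measure.restrict_smul, lintegral_smul_measure, setLIntegral_map hsm hBh hLm, himg,
    setLIntegral_congr hae, hcov, ← lintegral_indicator (hDP.inter hDgm), smul_eq_mul,
    ← lintegral_indicator hPm]
  have hpt : ∀ x : G × ℝ, c * (DP ∩ Dg).indicator (fun x => ENNReal.ofReal |(DF L (fderiv ℝ w x.1) (w x.1) x.2).det| *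
      B.indicator h (L (f x))) x = (Prod.fst ⁻¹' P).indicator ((Fw L r w ⁻¹' B).indicator (rd u Ω L r δ w h c)) x := by
    intro x
    by_cases h1 : x.1 ∈ P
    swap
    · rw [Set.indicator_of_notMem (fun hx => h1 hx.1.2), Set.indicator_of_notMem (s := Prod.fst ⁻¹' P) h1, mul_zero]
    rw [Set.indicator_of_mem (s := Prod.fst ⁻¹' P) h1]
    by_cases h2 : x ∈ D0 u Ω L r δ ∩ Dg
    · rw [Set.indicator_of_mem (s := DP ∩ Dg) ⟨⟨h2.1, h1⟩, h2.2⟩, hLf]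
      by_cases h3 : Fw L r w x ∈ B
      · rw [Set.indicator_of_mem h3, Set.indicator_of_mem (s := Fw L r w ⁻¹' B) h3, rd, Set.indicator_of_mem h2]
      · rw [Set.indicator_of_notMem h3, Set.indicator_of_notMem (s := Fw L r w ⁻¹' B) h3, mul_zero, mul_zero]
    · rw [Set.indicator_of_notMem (s := DP ∩ Dg) (fun hx => h2 ⟨hx.1.1, hx.2⟩), mul_zero]
      by_cases h3 : Fw L r w x ∈ B
      · rw [Set.indicator_of_mem (s := Fw L r w ⁻¹' B) h3, rd, Set.indicator_of_notMem h2, mul_zero]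
      · rw [Set.indicator_of_notMem (s := Fw L r w ⁻¹' B) h3]
  have hmr := rd_meas hu hΩ hw hwe hh c
  rw [← lintegral_const_mul' c _ hcne]
  simp_rw [hpt]
  rw [lintegral_prod _ (((hmr.indicator ((Fw_cont hw).measurable hB)).indicator (measurable_fst hPm)).aemeasurable)]
  refine lintegral_congr fun y => ?_
  by_cases h1 : y ∈ P
  · rw [Set.indicator_of_mem h1, eta_apply hu hΩ hw hwe hh c y hB]
    refine lintegral_congr fun t => ?_
    rw [Set.indicator_of_mem (s := Prod.fst ⁻¹' P) (show (y,t) ∈ _ from h1)]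
  · rw [Set.indicator_of_notMem h1]
    simp [Set.indicator_of_notMem (s := Prod.fst ⁻¹' P) (show (y,_) ∉ Prod.fst ⁻¹' P from h1)]
end chart2
end NL

set_option linter.unusedSectionVars false
namespace NL
open scoped Pointwise
section chart3
open Filter Topology
variable {G : Type*} [NormedAddCommGroup G] [NormedSpace ℝ G] [FiniteDimensional ℝ G]
  [MeasurableSpace G] [BorelSpace G] (lamG : Measure G) [lamG.IsAddHaarMeasure]
variable {E : Type*} [NormedAddCommGroup E] [InnerProductSpace ℝ E] [FiniteDimensional ℝ E]
  [MeasurableSpace E] [BorelSpace E] (vol : Measure E) [vol.IsAddHaarMeasure]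
variable {u : E → ℝ} {Ω : Set E} {L : (G × ℝ) ≃L[ℝ] E} {r δ : ℝ} {w : G → E} {K : NNReal}

/-- needle measures on a general space -/
def Needle (κ : ℝ) (Ω : Set E) (η : Measure E) : Prop :=
  ∃ (A : Set ℝ) (Ψ : ℝ → ℝ) (γ : ℝ → E),
    A.Nonempty ∧ IsOpen A ∧ A.OrdConnected ∧
    ContDiffOn ℝ (⊤ : ℕ∞) Ψ A ∧ (∀ t ∈ A, κ ≤ deriv (deriv Ψ) t) ∧
    Measurable γ ∧ (∀ t ∈ A, γ t ∈ Ω) ∧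
    (∀ s ∈ A, ∀ t ∈ A, ‖γ s - γ t‖ = |s - t|) ∧
    η = Measure.map γ
      ((volume.restrict A).withDensity fun t => ENNReal.ofReal (Real.exp (-Ψ t)))

def Ay (u : E → ℝ) (Ω : Set E) (x : E) : Set ℝ := {t | t ∈ T u x ∧ x + t • vf u x ∈ Ω}

lemma Ay_open (hΩ : IsOpen Ω) (x : E) : IsOpen (Ay u Ω x) :=
  (T_open x).inter (hΩ.preimage (show Continuous fun t : ℝ => x + t • vf u x by fun_prop))

lemma Ay_ord (hu : Lip1 u) (hconv : Convex ℝ Ω) (x : E) : (Ay u Ω x).OrdConnected := by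
  have h1 : Convex ℝ {t : ℝ | x + t • vf u x ∈ Ω} := by
    intro s hs t ht a b ha hb hab
    have := hconv hs ht ha hb hab
    show x + (a • s + b • t) • vf u x ∈ Ω
    convert this using 1
    simp only [smul_add, smul_eq_mul]
    have : x = a • x + b • x := by rw [← add_smul, hab, one_smul]
    nth_rewrite 1 [this]
    module
  exact (T_ord hu x).inter h1.ordConnected

lemma Ay_image (x : E) : (fun t : ℝ => x + t • vf u x) '' (Ay u Ω x) = O u x ∩ Ω := by
  ext z
  constructor
  · rintro ⟨t, ⟨h1, h2⟩, rfl⟩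
    exact ⟨⟨t, h1, rfl⟩, h2⟩
  · rintro ⟨⟨t, h1, rfl⟩, h2⟩
    exact ⟨t, ⟨h1, h2⟩, rfl⟩

lemma line_isom {x e : E} (he : ‖e‖ = 1) (s t : ℝ) : ‖(x + s • e) - (x + t • e)‖ = |s - t| := by
  have : (x + s • e) - (x + t • e) = (s - t) • e := by module
  rw [this, norm_smul, he, mul_one, Real.norm_eq_abs]

lemma eta_needle (hu : Lip1 u) (hΩ : IsOpen Ω) (hconv : Convex ℝ Ω) (hδ : 0 < δ)
    (hwe : ∀ y, L (y, r) ∈ R u δ δ → w y = vf u (L (y, r))) {κ : ℝ} {ρ : E → ℝ}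
    (hρ : ContDiffOn ℝ (⊤ : ℕ∞) ρ Ω)
    (hHess : ∀ x ∈ Ω, ∀ v : E, κ * ‖v‖ ^ 2 ≤ iteratedFDerivWithin ℝ 2 ρ Ω x ![v, v])
    {c : ℝ≥0∞} (hc0 : c ≠ 0) (hcne : c ≠ ⊤) {y : G} (hy : y ∈ Cc u Ω L r δ)
    (hg : DetGood u L r w y) :
    (eta u Ω L r δ w (Ω.indicator fun x => ENNReal.ofReal (Real.exp (-ρ x))) c y)
        (O u (L (y, r)) ∩ Ω)ᶜ = 0 ∧
    Needle κ Ω (eta u Ω L r δ w (Ω.indicator fun x => ENNReal.ofReal (Real.exp (-ρ x))) c y) := by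
  obtain ⟨hdiff, lam, d0, hd0, hpos, hdet⟩ := hg
  set x := L (y, r) with hx
  set e := vf u x with he
  have hwy : w y = e := hwe y hy.2.1
  have hxX : x ∈ X u := ⟨δ, hδ, hy.2.1⟩
  have hen : ‖e‖ = 1 := vf_norm hxX
  let A := Ay u Ω x
  have hAo : IsOpen A := Ay_open hΩ x
  have hcr : 0 < c.toReal := ENNReal.toReal_pos hc0 hcne
  obtain ⟨Ψ, h1, h2, h3⟩ := psi_props hΩ hρ hHess lam (mul_pos hcr hd0) hAo (x := x) hen
    (fun t ht => ht.2) (fun t ht => hpos t ht.1)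
  let γ : ℝ → E := fun t => x + t • e
  have hγc : Continuous γ := by fun_prop
  have hFγ : (fun t => Fw L r w (y, t)) = γ := by
    funext t; simp only [Fw, γ]; rw [hwy]
  have hdens : (fun t => rd u Ω L r δ w (Ω.indicator fun x => ENNReal.ofReal (Real.exp (-ρ x))) c (y, t))
      = A.indicator (fun t => ENNReal.ofReal (Real.exp (-Ψ t))) := by
    funext t
    by_cases ht : t ∈ A
    · have hm : (y, t) ∈ D0 u Ω L r δ ∩ Prod.fst ⁻¹' {y | DifferentiableAt ℝ w y} :=
        ⟨⟨hy, ht.1, ht.2⟩, hdiff⟩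
      rw [Set.indicator_of_mem ht, rd, Set.indicator_of_mem hm]
      have hF : Fw L r w (y, t) = x + t • e := congrFun hFγ t
      rw [hF, Set.indicator_of_mem ht.2]
      simp only
      rw [hdet t ht.1, h3 t ht]
      conv_lhs => rw [← ENNReal.ofReal_toReal hcne]
      rw [← ENNReal.ofReal_mul (mul_nonneg hd0.le (Finset.prod_nonneg fun i _ => (hpos t ht.1 i).le)),
        ← ENNReal.ofReal_mul hcr.le]
      congr 1
      ring
    · have hm : (y, t) ∉ D0 u Ω L r δ ∩ Prod.fst ⁻¹' {y | DifferentiableAt ℝ w y} :=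
        fun h => ht ⟨h.1.2.1, h.1.2.2⟩
      rw [Set.indicator_of_notMem ht, rd, Set.indicator_of_notMem hm, mul_zero]
  have heta : eta u Ω L r δ w (Ω.indicator fun x => ENNReal.ofReal (Real.exp (-ρ x))) c y
      = Measure.map γ ((volume.restrict A).withDensity fun t => ENNReal.ofReal (Real.exp (-Ψ t))) := by
    rw [eta, hFγ, hdens, withDensity_indicator hAo.measurableSet]
  have hiso : ∀ s t, ‖γ s - γ t‖ = |s - t| := line_isom hen
  refine ⟨?_, A, Ψ, γ, ⟨0, zero_mem_T hxX, by simpa using hy.1⟩, hAo, Ay_ord hu hconv x, h1, h2,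
    hγc.measurable, fun t ht => ht.2, fun s _ t _ => hiso s t, heta⟩
  have him : MeasurableSet (O u x ∩ Ω) := by
    rw [← Ay_image]
    refine hAo.measurableSet.image_of_continuousOn_injOn hγc.continuousOn ?_
    intro s _ t _ hst
    have h4 := hiso s t
    rw [show γ s = γ t from hst, sub_self, norm_zero] at h4
    exact sub_eq_zero.1 (abs_eq_zero.1 h4.symm)
  rw [heta, Measure.map_apply hγc.measurable him.compl]
  refine withDensity_absolutelyContinuous _ _ ?_
  rw [Measure.restrict_apply (hγc.measurable him.compl)]
  have : γ ⁻¹' (O u x ∩ Ω)ᶜ ∩ A = ∅ := by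
    rw [← Ay_image, Set.eq_empty_iff_forall_notMem]
    rintro t ⟨h4, h5⟩
    exact h4 ⟨t, h5, rfl⟩
  rw [this, measure_empty]

lemma chart_main (hu : Lip1 u) (hΩ : IsOpen Ω) (hconv : Convex ℝ Ω) {κ : ℝ} {ρ : E → ℝ}
    (hρ : ContDiffOn ℝ (⊤ : ℕ∞) ρ Ω)
    (hHess : ∀ x ∈ Ω, ∀ v : E, κ * ‖v‖ ^ 2 ≤ iteratedFDerivWithin ℝ 2 ρ Ω x ![v, v])
    {μ : Measure E} (hμ : μ = (vol.restrict Ω).withDensity fun x => ENNReal.ofReal (Real.exp (-ρ x)))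
    (L : (G × ℝ) ≃L[ℝ] E) (r : ℝ) {δ : ℝ} (hδ : 0 < δ) :
    MeasurableSet (Cc u Ω L r δ) ∧ ∃ η : G → Measure E, Measurable η ∧
      (∀ P : Set G, MeasurableSet P → P ⊆ Cc u Ω L r δ → ∀ B : Set E, MeasurableSet B →
        μ (B ∩ sat u Ω L r P) = ∫⁻ y in P, η y B ∂lamG) ∧
      ∀ᵐ y ∂lamG, y ∈ Cc u Ω L r δ → (η y) (O u (L (y, r)) ∩ Ω)ᶜ = 0 ∧ Needle κ Ω (η y) := by
  obtain ⟨w, K, hw, hwe⟩ := exists_w u hu L r hδ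
  haveI : (Measure.map L (lamG.prod volume)).IsAddHaarMeasure := L.isAddHaarMeasure_map _
  let c : NNReal := Measure.addHaarScalarFactor vol (Measure.map L (lamG.prod volume))
  have hc : vol = (c : ℝ≥0∞) • Measure.map L (lamG.prod volume) :=
    Measure.isAddLeftInvariant_eq_smul vol _
  have hc0 : (c : ℝ≥0∞) ≠ 0 := by
    have := Measure.addHaarScalarFactor_pos_of_isAddHaarMeasure vol (Measure.map L (lamG.prod volume))
    exact_mod_cast this.ne'
  have hh : Measurable (Ω.indicator fun x => ENNReal.ofReal (Real.exp (-ρ x))) := by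
    have h1 : ContinuousOn (fun x => ENNReal.ofReal (Real.exp (-ρ x))) Ω :=
      ENNReal.continuous_ofReal.comp_continuousOn (Real.continuous_exp.comp_continuousOn hρ.continuousOn.neg)
    classical
    rw [← Set.piecewise_eq_indicator]
    exact h1.measurable_piecewise continuousOn_const hΩ.measurableSet
  have hμ' : μ = vol.withDensity (Ω.indicator fun x => ENNReal.ofReal (Real.exp (-ρ x))) := by
    rw [hμ, withDensity_indicator hΩ.measurableSet]
  refine ⟨Cc_meas hu hΩ hw hwe, eta u Ω L r δ w (Ω.indicator fun x => ENNReal.ofReal (Real.exp (-ρ x))) c,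
    eta_meas hu hΩ hw hwe hh _, ?_, ?_⟩
  · intro P hPm hP B hB
    rw [hμ']
    exact cov lamG vol hu hΩ hδ hw hwe hh ENNReal.coe_ne_top hc hPm hP hB
  · filter_upwards [det_ae (Ω := Ω) lamG hu hδ hw hwe] with y hy hyC
    exact eta_needle hu hΩ hconv hδ hwe hρ hHess hc0 ENNReal.coe_ne_top hyC (hy hyC)
end chart3
end NL

set_option linter.unusedSectionVars false
namespace NL
open scoped Pointwise
section fib
open Filter Topology
variable {Y : Type*} [MeasurableSpace Y] {lam : Measure Y} [SigmaFinite lam]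
variable {E : Type*} [MeasurableSpace E]

lemma fib_zero {μ : Measure E} {f : E → ℝ} (hf : Integrable f μ) {C : Set Y} (hC : MeasurableSet C)
    {S : Set Y → Set E} (hS : ∀ P, MeasurableSet P → P ⊆ C → MeasurableSet (S P))
    {η : Y → Measure E} (hη : Measurable η)
    (hdis : ∀ P : Set Y, MeasurableSet P → P ⊆ C → ∀ B : Set E, MeasurableSet B →
        μ (B ∩ S P) = ∫⁻ y in P, η y B ∂lam)
    (hbal : ∀ P, MeasurableSet P → P ⊆ C → ∫ x in S P, f x ∂μ = 0) :
    ∀ᵐ y ∂lam, y ∈ C → ∫ x, f x ∂(η y) = 0 := by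
  obtain ⟨f', hf'm, hff'⟩ := hf.1
  have hf'm := hf'm.measurable
  have hf'i : Integrable f' μ := hf.congr hff'
  have hbal' : ∀ P, MeasurableSet P → P ⊆ C → ∫ x in S P, f' x ∂μ = 0 := fun P h1 h2 => by
    rw [← hbal P h1 h2]
    exact integral_congr_ae (ae_restrict_of_ae (hff'.symm))
  have hlin : ∀ P : Set Y, MeasurableSet P → P ⊆ C → ∀ g : E → ℝ≥0∞, Measurable g →
      ∫⁻ x in S P, g x ∂μ = ∫⁻ y in P, ∫⁻ x, g x ∂(η y) ∂lam := by
    intro P h1 h2 g hg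
    have h3 : μ.restrict (S P) = (lam.restrict P).bind η := by
      ext B hB
      rw [Measure.restrict_apply hB, hdis P h1 h2 B hB, Measure.bind_apply hB hη.aemeasurable]
    rw [h3, Measure.lintegral_bind hη.aemeasurable hg.aemeasurable]
  -- null sets
  obtain ⟨N, hN1, hNm, hN0⟩ := exists_measurable_superset_of_null (ae_iff.1 hff')
  have hNη : ∀ᵐ y ∂lam, y ∈ C → η y N = 0 := by
    have h1 : ∫⁻ y in C, η y N ∂lam = 0 := by
      rw [← hdis C hC subset_rfl N hNm]
      exact measure_mono_null Set.inter_subset_left hN0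
    have hm : Measurable fun y => η y N := (Measure.measurable_coe hNm).comp hη
    rw [lintegral_eq_zero_iff hm] at h1
    exact (ae_restrict_iff' hC).1 h1
  have hgp : Measurable fun x => ENNReal.ofReal (f' x) := hf'm.ennreal_ofReal
  have hgn : Measurable fun x => ENNReal.ofReal (-f' x) := hf'm.neg.ennreal_ofReal
  have hΦp : Measurable fun y => ∫⁻ x, ENNReal.ofReal (f' x) ∂(η y) :=
    (Measure.measurable_lintegral hgp).comp hη
  have hΦn : Measurable fun y => ∫⁻ x, ENNReal.ofReal (-f' x) ∂(η y) :=
    (Measure.measurable_lintegral hgn).comp hη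
  have heq : (fun y => ∫⁻ x, ENNReal.ofReal (f' x) ∂(η y)) =ᵐ[lam.restrict C]
      fun y => ∫⁻ x, ENNReal.ofReal (-f' x) ∂(η y) := by
    refine ae_eq_of_forall_setLIntegral_eq_of_sigmaFinite hΦp hΦn fun s hs _ => ?_
    rw [Measure.restrict_restrict hs, ← hlin _ (hs.inter hC) Set.inter_subset_right _ hgp,
      ← hlin _ (hs.inter hC) Set.inter_subset_right _ hgn]
    have h1 := hbal' _ (hs.inter hC) Set.inter_subset_right
    have h2 : Integrable f' (μ.restrict (S (s ∩ C))) := hf'i.restrict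
    rw [integral_eq_lintegral_pos_part_sub_lintegral_neg_part h2, sub_eq_zero] at h1
    have h3 : ∫⁻ x in S (s ∩ C), ENNReal.ofReal (f' x) ∂μ ≠ ⊤ := h2.lintegral_lt_top.ne
    have h4 : ∫⁻ x in S (s ∩ C), ENNReal.ofReal (-f' x) ∂μ ≠ ⊤ := h2.neg.lintegral_lt_top.ne
    exact (ENNReal.toReal_eq_toReal_iff' h3 h4).1 h1
  have heq' := (ae_restrict_iff' hC).1 heq
  filter_upwards [hNη, heq'] with y h1 h2 hy
  have h3 : f =ᵐ[η y] f' := measure_mono_null hN1 (h1 hy)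
  rw [integral_congr_ae h3]
  by_cases h4 : Integrable f' (η y)
  · rw [integral_eq_lintegral_pos_part_sub_lintegral_neg_part h4, h2 hy, sub_self]
  · exact integral_undef h4
end fib

section bal
open Filter Topology
variable {G : Type*} [NormedAddCommGroup G] [NormedSpace ℝ G] [FiniteDimensional ℝ G]
  [MeasurableSpace G] [BorelSpace G] 
variable {E : Type*} [NormedAddCommGroup E] [InnerProductSpace ℝ E] [FiniteDimensional ℝ E]
  [MeasurableSpace E] [BorelSpace E] (vol : Measure E) [vol.IsAddHaarMeasure]
variable {u : E → ℝ} {Ω : Set E} {L : (G × ℝ) ≃L[ℝ] E} {r δ : ℝ}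

lemma vf_neg (hu : Lip1 u) {x : E} (hx : x ∈ X u) : vf (fun x => - u x) x = - vf u x := by
  obtain ⟨d, hd, h⟩ := hx
  have h1 := vf_seg hu hd hd h
  refine vf_eq hu.neg hd hd ?_
  rw [Seg_neg, neg_neg]
  exact h1

lemma T_neg {x : E} {t : ℝ} : t ∈ T (fun x => - u x) x ↔ -t ∈ T u x := by
  constructor
  · rintro ⟨a, b, ha, hb, h1, h2, h3⟩
    rw [R_neg] at h3
    exact ⟨b, a, hb, ha, by linarith, by linarith, h3⟩
  · rintro ⟨a, b, ha, hb, h1, h2, h3⟩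
    rw [← R_neg] at h3
    exact ⟨b, a, hb, ha, by linarith, by linarith, h3⟩

lemma O_neg (hu : Lip1 u) {x : E} (hx : x ∈ X u) : O (fun x => - u x) x ⊆ O u x := by
  rintro _ ⟨t, ht, rfl⟩
  refine ⟨-t, T_neg.1 ht, ?_⟩
  simp only
  rw [vf_neg hu hx]; module

variable {μ : Measure E} {f : E → ℝ} {x₀ : E}

lemma sat_bal (hu : Lip1 u) (hΩ : IsOpen Ω) (hδ : 0 < δ) (hac : μ ≪ vol) (hμΩ : μ Ωᶜ = 0)
    (hf : Integrable f μ) (hfd : Integrable (fun x => |f x| * ‖x - x₀‖) μ)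
    (hopt : ∀ g : E → ℝ, Lip1 g → ∫ x, g x * f x ∂μ ≤ ∫ x, u x * f x ∂μ) {P : Set G}
    (hP : P ⊆ Cc u Ω L r δ) (hPm : MeasurableSet P) : ∫ x in sat u Ω L r P, f x ∂μ = 0 := by
  have key : ∀ x y, y ∈ sat u Ω L r P → x ∉ sat u Ω L r P → x ∈ O u y → x ∈ Ωᶜ := by
    rintro x y ⟨h1, y', hy', h2⟩ h3 h4 h5
    rw [(O_eq hu h2).2.2] at h4
    exact h3 ⟨h5, y', hy', h4⟩
  refine bal_eq hf hfd hu hopt (sat_meas hu hΩ hδ hP hPm) ?_ ?_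
  · refine measure_mono_null (t := Ωᶜ ∪ Lo u) ?_ (measure_union_null hμΩ (hac (Lo_null vol hu)))
    rintro x ⟨⟨y, hy, h⟩, hx⟩
    obtain ⟨h1, y', hy', h2⟩ := id hy
    rcases Dn_X hu (O_eq hu h2).1 h with h3 | h3
    · exact Or.inl (key x y hy hx h3)
    · exact Or.inr h3
  · refine measure_mono_null (t := Ωᶜ ∪ Lo (fun x => - u x)) ?_
      (measure_union_null hμΩ (hac (Lo_null vol hu.neg)))
    rintro x ⟨⟨y, hy, h⟩, hx⟩
    obtain ⟨h1, y', hy', h2⟩ := id hy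
    have hyX := (O_eq hu h2).1
    rcases Dn_X hu.neg (by rw [X_neg]; exact hyX) h with h3 | h3
    · exact Or.inl (key x y hy hx (O_neg hu hyX h3))
    · exact Or.inr h3

lemma sing_zero (hu : Lip1 u) (hac : μ ≪ vol)
    (hf : Integrable f μ) (hfd : Integrable (fun x => |f x| * ‖x - x₀‖) μ)
    (hopt : ∀ g : E → ℝ, Lip1 g → ∫ x, g x * f x ∂μ ≤ ∫ x, u x * f x ∂μ) :
    ∀ᵐ x ∂μ, x ∉ X u → f x = 0 := by
  have hb : ∀ s, MeasurableSet s → ∫ x in s ∩ (X u)ᶜ, f x ∂μ = 0 := by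
    intro s hs
    let N := toMeasurable vol (Lo u ∪ Lo (fun x => - u x))
    have hNv : vol N = 0 := by
      rw [measure_toMeasurable]; exact measure_union_null (Lo_null vol hu) (Lo_null vol hu.neg)
    have hN0 : μ N = 0 := hac hNv
    have hNs : Lo u ∪ Lo (fun x => - u x) ⊆ N := subset_toMeasurable _ _
    have hNm : MeasurableSet N := measurableSet_toMeasurable _ _
    have hae : (s ∩ (X u)ᶜ : Set E) =ᵐ[μ] ((s ∩ (X u)ᶜ) \ N : Set E) := (sdiff_null_ae_eq_self hN0).symm
    rw [setIntegral_congr_set hae]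
    have key : ∀ y ∈ (s ∩ (X u)ᶜ) \ N, ∀ x, x ≠ y → (u y - u x = ‖y - x‖ → False) ∧
        (u x - u y = ‖y - x‖ → False) := by
      intro y hy x hxy
      constructor
      · intro h
        obtain ⟨e, he, -⟩ := Dn_seg (u := fun x => - u x) hxy
          (show -u x - -u y = ‖x - y‖ by rw [norm_sub_rev]; linarith)
        refine hy.2 (hNs (Or.inr ⟨?_, ‖x - y‖, norm_pos_iff.2 (sub_ne_zero.2 hxy), e, he⟩))
        rw [X_neg]; exact hy.1.2
      · intro h
        obtain ⟨e, he, -⟩ := Dn_seg (u := u) hxy (by rw [norm_sub_rev]; linarith)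
        exact hy.2 (hNs (Or.inl ⟨hy.1.2, ‖x - y‖, norm_pos_iff.2 (sub_ne_zero.2 hxy), e, he⟩))
    refine bal_eq hf hfd hu hopt ((hs.inter (X_meas hu).compl).diff hNm) ?_ ?_
    · convert measure_empty (μ := μ)
      rw [Set.eq_empty_iff_forall_notMem]
      rintro x ⟨⟨y, hy, h⟩, hx⟩
      exact (key y hy x (fun h => hx (h ▸ hy))).1 h
    · convert measure_empty (μ := μ)
      rw [Set.eq_empty_iff_forall_notMem]
      rintro x ⟨⟨y, hy, h⟩, hx⟩
      exact (key y hy x (fun h => hx (h ▸ hy))).2 (by linarith)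
  have h1 : f =ᵐ[μ.restrict (X u)ᶜ] 0 := by
    refine hf.restrict.ae_eq_zero_of_forall_setIntegral_eq_zero fun s hs _ => ?_
    rw [Measure.restrict_restrict hs]
    exact hb s hs
  exact (ae_restrict_iff' (X_meas hu).compl).1 h1
end bal
end NL

set_option linter.unusedSectionVars false
namespace NL
open scoped Pointwise
section glue
open Filter Topology

lemma measSet_sigma {G : ℕ → Type} [∀ c, MeasurableSpace (G c)] {s : Set (Σ c, G c)} :
    MeasurableSet s ↔ ∀ c, MeasurableSet (Sigma.mk c ⁻¹' s) := MeasurableSpace.measurableSet_iInf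

lemma emb_sigma {G : ℕ → Type} [∀ c, MeasurableSpace (G c)] (c : ℕ) :
    MeasurableEmbedding (Sigma.mk c : G c → Σ c, G c) := by
  refine ⟨sigma_mk_injective, fun s hs => measSet_sigma.1 hs c, ?_⟩
  intro s hs
  rw [measSet_sigma]
  intro d
  by_cases h : d = c
  · subst h
    rwa [Set.preimage_image_eq _ sigma_mk_injective]
  · convert MeasurableSet.empty
    rw [Set.eq_empty_iff_forall_notMem]
    rintro y ⟨x, hx, he⟩
    exact h (congrArg Sigma.fst he).symm

lemma glue {E G : Type} [MeasurableSpace E] [MeasurableSpace G]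
    {lam : Measure G} {μ : Measure E} {Z : Set E} (hZ : MeasurableSet Z)
    {P : ℕ → Set G} (hP : ∀ c, MeasurableSet (P c)) {S : ℕ → Set E} (hS : ∀ c, MeasurableSet (S c))
    {Ω : Set E} (hΩ : MeasurableSet Ω) (hμΩ : μ Ωᶜ = 0)
    (cls : ℕ → G → Set E) (hScls : ∀ c, S c = ⋃ y ∈ P c, cls c y)
    (hZS : ∀ c, Disjoint Z (S c)) (hSS : Pairwise fun c d => Disjoint (S c) (S d))
    (hcov : Z ∪ ⋃ c, S c = Ω)
    (hcls : ∀ c, ∀ y ∈ P c, ∀ y' ∈ P c, y ≠ y' → Disjoint (cls c y) (cls c y'))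
    (hne : ∀ c, ∀ y ∈ P c, (cls c y).Nonempty)
    (η : ℕ → G → Measure E) (hη : ∀ c, Measurable (η c))
    (hdis : ∀ c B, MeasurableSet B → μ (B ∩ S c) = ∫⁻ y in P c, η c y B ∂lam)
    (pa : Set E → Prop) (hpa1 : ∀ z, pa {z}) (hpa2 : ∀ c, ∀ y ∈ P c, pa (cls c y))
    (nd : Measure E → Prop) (hnd : ∀ c, ∀ᵐ y ∂lam, y ∈ P c → η c y (cls c y)ᶜ = 0 ∧ nd (η c y))
    (zr : Measure E → Prop) (hzr : ∀ c, ∀ᵐ y ∂lam, y ∈ P c → zr (η c y))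
    (hzrZ : ∀ᵐ z ∂μ, z ∈ Z → zr (Measure.dirac z)) [MeasurableSingletonClass E] :
    ∃ (Q : Type) (m : MeasurableSpace Q) (ν : @Measure Q m) (I : Q → Set E) (μq : Q → Measure E),
      (∀ q, (I q).Nonempty) ∧
      (Pairwise fun q q' => Disjoint (I q) (I q')) ∧
      (⋃ q, I q) = Ω ∧
      (∀ q, pa (I q)) ∧
      (∀ B : Set E, MeasurableSet B →
        (@Measurable Q ℝ≥0∞ m inferInstance fun q => μq q B) ∧ μ B = ∫⁻ q, μq q B ∂ν) ∧
      (∀ᵐ q ∂ν, μq q (I q)ᶜ = 0 ∧ ((∃ x, I q = {x}) ∨ nd (μq q))) ∧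
      (∀ᵐ q ∂ν, zr (μq q)) := by
  have hsub : ∀ c, ∀ y ∈ P c, cls c y ⊆ S c := fun c y hy => by
    rw [hScls]; exact Set.subset_biUnion_of_mem (u := cls c) hy
  let iL : ∀ c, P c → (Σ c, P c) ⊕ Z := fun c y => Sum.inl ⟨c, y⟩
  have hiL : ∀ c, MeasurableEmbedding (iL c) := fun c =>
    (MeasurableEmbedding.mk Sum.inl_injective measurable_inl fun _ h => h.inl_image).comp (emb_sigma (G := fun c => P c) c)
  have hiR : MeasurableEmbedding (Sum.inr : Z → (Σ c, P c) ⊕ Z) :=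
    MeasurableEmbedding.mk Sum.inr_injective measurable_inr fun _ h => h.inr_image
  let ν : Measure ((Σ c, P c) ⊕ Z) :=
    Measure.sum (fun c => (lam.comap Subtype.val).map (iL c)) + (μ.comap Subtype.val).map Sum.inr
  let I : (Σ c, P c) ⊕ Z → Set E := Sum.elim (fun p => cls p.1 p.2) (fun z => {(z : E)})
  let μq : (Σ c, P c) ⊕ Z → Measure E := Sum.elim (fun p => η p.1 p.2) (fun z => Measure.dirac (z : E))
  have hae : ∀ p : (Σ c, P c) ⊕ Z → Prop, (∀ c, ∀ᵐ y ∂lam, ∀ h : y ∈ P c, p (Sum.inl ⟨c, y, h⟩)) →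
      (∀ᵐ z ∂μ, ∀ h : z ∈ Z, p (Sum.inr ⟨z, h⟩)) → ∀ᵐ q ∂ν, p q := by
    intro p h1 h2
    have gen : ∀ {F : Type} [MeasurableSpace F] (τ : Measure F) (s : Set F) (hs : MeasurableSet s)
        (p : s → Prop), (∀ᵐ y ∂τ, ∀ h : y ∈ s, p ⟨y, h⟩) → ∀ᵐ y ∂(τ.comap Subtype.val), p y := by
      intro F _ τ s hs p h
      rw [ae_iff, comap_subtype_coe_apply hs]
      refine measure_mono_null ?_ (ae_iff.1 h)
      rintro _ ⟨y, hy, rfl⟩ h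
      exact hy (h y.2)
    show ∀ᵐ q ∂(_ + _), p q
    rw [ae_add_measure_iff]
    constructor
    · rw [Measure.ae_sum_iff]
      intro c
      rw [(hiL c).ae_map_iff]
      exact gen _ _ (hP c) (fun y => p (Sum.inl ⟨c, y⟩)) (h1 c)
    · rw [hiR.ae_map_iff]
      exact gen _ _ hZ (fun y => p (Sum.inr y)) h2
  refine ⟨_, inferInstance, ν, I, μq, ?_, ?_, ?_, ?_, ?_, ?_, ?_⟩
  · rintro (⟨c, y⟩ | z)
    · exact hne c y y.2
    · exact Set.singleton_nonempty _
  · rintro (⟨c, y⟩ | z) (⟨d, y'⟩ | z') h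
    · by_cases hcd : c = d
      · subst hcd
        refine hcls c y y.2 y' y'.2 fun h' => h ?_
        rw [Subtype.ext h']
      · exact (hSS hcd).mono (hsub c y y.2) (hsub d y' y'.2)
    · exact (hZS c).symm.mono (hsub c y y.2) (Set.singleton_subset_iff.2 z'.2)
    · exact (hZS d).mono (Set.singleton_subset_iff.2 z.2) (hsub d y' y'.2)
    · refine Set.disjoint_singleton.2 fun h' => h ?_
      rw [Subtype.ext h']
  · rw [← hcov]
    ext z
    constructor
    · intro h
      obtain ⟨q, hq⟩ := Set.mem_iUnion.1 h
      rcases q with ⟨c, y⟩ | z'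
      · exact Or.inr (Set.mem_iUnion.2 ⟨c, hsub c y y.2 hq⟩)
      · rw [show z = z' from hq]; exact Or.inl z'.2
    · rintro (h | h)
      · exact Set.mem_iUnion.2 ⟨Sum.inr ⟨z, h⟩, rfl⟩
      · obtain ⟨c, hc⟩ := Set.mem_iUnion.1 h
        rw [hScls] at hc
        obtain ⟨y, hy, hz⟩ := Set.mem_iUnion₂.1 hc
        exact Set.mem_iUnion.2 ⟨Sum.inl ⟨c, y, hy⟩, hz⟩
  · rintro (⟨c, y⟩ | z)
    · exact hpa2 c y y.2
    · exact hpa1 z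
  · intro B hB
    have m1 : ∀ c, Measurable fun y : G => η c y B := fun c => (Measure.measurable_coe hB).comp (hη c)
    have m2 : Measurable fun z : E => Measure.dirac z B :=
      (Measure.measurable_coe hB).comp Measure.measurable_dirac
    have m : Measurable fun q => μq q B := by
      have e : (fun q => μq q B) = Sum.elim (fun p : Σ c, P c => η p.1 p.2 B)
          (fun z : Z => Measure.dirac (z : E) B) := by
        ext q; rcases q with q | q <;> rfl
      rw [e]
      refine Measurable.sumElim ?_ (m2.comp measurable_subtype_coe)
      intro s hs
      rw [measSet_sigma]
      intro c
      exact ((m1 c).comp measurable_subtype_coe) hs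
    refine ⟨m, ?_⟩
    show _ = ∫⁻ q, μq q B ∂(_ + _)
    rw [lintegral_add_measure, lintegral_sum_measure, lintegral_map m hiR.measurable]
    have e1 : ∀ c, ∫⁻ q, μq q B ∂((lam.comap Subtype.val).map (iL c)) = μ (B ∩ S c) := by
      intro c
      rw [lintegral_map m (hiL c).measurable, hdis c B hB]
      exact lintegral_subtype_comap (hP c) (fun y => η c y B)
    have e2 : ∫⁻ z : Z, μq (Sum.inr z) B ∂(μ.comap Subtype.val) = μ (B ∩ Z) := by
      refine (lintegral_subtype_comap hZ (fun y => Measure.dirac y B)).trans ?_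
      have : (fun y => Measure.dirac y B) = B.indicator (1 : E → ℝ≥0∞) := by
        ext y; rw [Measure.dirac_apply' _ hB]
      rw [this, lintegral_indicator_one hB, Measure.restrict_apply hB]
    simp_rw [e1]
    rw [e2, ← measure_iUnion (fun c d h => (hSS h).mono Set.inter_subset_right Set.inter_subset_right)
      (fun c => hB.inter (hS c)), ← Set.inter_iUnion, ← measure_union _ (hB.inter hZ),
      ← Set.inter_union_distrib_left, Set.union_comm, hcov]
    · exact (measure_inter_conull hμΩ).symm
    · refine Disjoint.mono Set.inter_subset_right Set.inter_subset_right ?_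
      rw [Set.disjoint_iUnion_left]
      exact fun c => (hZS c).symm
  · refine hae _ ?_ ?_
    · intro c
      filter_upwards [hnd c] with y h1 h2
      exact ⟨(h1 h2).1, Or.inr (h1 h2).2⟩
    · refine Eventually.of_forall fun z h => ⟨?_, Or.inl ⟨z, rfl⟩⟩
      show Measure.dirac z ({z} : Set E)ᶜ = 0
      rw [Measure.dirac_apply' _ (measurableSet_singleton z).compl]
      simp
  · exact hae _ hzr hzrZ
end glue
end NL

set_option linter.unusedSectionVars false
namespace NL
open scoped Pointwise
section charts
open Filter Topology

def coordL {m : ℕ} (i : Fin (m+1)) : EuclideanSpace ℝ (Fin (m+1)) ≃ₗ[ℝ] ((Fin m → ℝ) × ℝ) where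
  toFun z := (fun j => z (i.succAbove j), z i)
  map_add' _ _ := rfl
  map_smul' _ _ := rfl
  invFun p := WithLp.toLp 2 (i.insertNth p.2 p.1)
  left_inv z := by
    ext j
    refine i.succAboveCases ?_ (fun j => ?_) j <;> simp
  right_inv p := by
    ext j <;> simp

noncomputable def Lc {m : ℕ} (i : Fin (m+1)) : ((Fin m → ℝ) × ℝ) ≃L[ℝ] EuclideanSpace ℝ (Fin (m+1)) :=
  (coordL i).symm.toContinuousLinearEquiv

lemma Lc_symm {m : ℕ} (i : Fin (m+1)) (z : EuclideanSpace ℝ (Fin (m+1))) : ((Lc i).symm z).2 = z i := rfl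

variable {m : ℕ} {u : EuclideanSpace ℝ (Fin (m+1)) → ℝ} {Ω : Set (EuclideanSpace ℝ (Fin (m+1)))}

lemma chart_cover (hu : Lip1 u) (hΩ : IsOpen Ω) {z : EuclideanSpace ℝ (Fin (m+1))} (hz : z ∈ X u) (hzΩ : z ∈ Ω) :
    ∃ (i : Fin (m+1)) (r : ℚ) (k : ℕ), z ∈ sat u Ω (Lc i) r (Cc u Ω (Lc i) r (1 / ((k:ℝ) + 1))) := by
  have hv := vf_norm hz
  obtain ⟨i, hi⟩ : ∃ i, (vf u z) i ≠ 0 := by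
    by_contra h
    push Not at h
    have : vf u z = 0 := by ext j; exact h j
    rw [this] at hv; simp at hv
  have ho : IsOpen ((fun r : ℝ => (r - z i) / (vf u z) i) ⁻¹' (Ay u Ω z)) :=
    (Ay_open hΩ z).preimage (by fun_prop)
  obtain ⟨r, hr⟩ := Rat.denseRange_cast (𝕜 := ℝ) |>.exists_mem_open ho
    ⟨z i, by show (z i - z i) / (vf u z) i ∈ Ay u Ω z; rw [sub_self, zero_div]; exact ⟨zero_mem_T hz, by simpa⟩⟩
  set t := ((r:ℝ) - z i) / (vf u z) i with ht
  have ht1 : t ∈ T u z := hr.1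
  have ht2 : z + t • vf u z ∈ Ω := hr.2
  set x := z + t • vf u z with hx
  have hxO : x ∈ O u z := ⟨t, ht1, rfl⟩
  obtain ⟨h1, h2, h3⟩ := O_eq hu hxO
  have hxi : x i = r := by
    rw [hx]; simp only [PiLp.add_apply, PiLp.smul_apply, smul_eq_mul, ht]
    field_simp; ring
  obtain ⟨k, hk⟩ := Set.mem_iUnion.1 (X_eq hu ▸ h1)
  have hL : Lc i (((Lc i).symm x).1, (r:ℝ)) = x := by
    rw [← hxi, ← Lc_symm]; exact (Lc i).apply_symm_apply x
  refine ⟨i, r, k, hzΩ, ((Lc i).symm x).1, ⟨?_, ?_, ?_⟩, ?_⟩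
  · rw [hL]; exact ht2
  · rw [hL]; exact hk
  · rw [hL, h2, Lc_symm]; exact hi
  · rw [hL, h3]; exact mem_O_self hz

lemma main {κ : ℝ} (hΩ : IsOpen Ω) (hconv : Convex ℝ Ω) {ρ : EuclideanSpace ℝ (Fin (m+1)) → ℝ}
    (hρ : ContDiffOn ℝ (⊤ : ℕ∞) ρ Ω)
    (hHess : ∀ x ∈ Ω, ∀ v, κ * ‖v‖ ^ 2 ≤ iteratedFDerivWithin ℝ 2 ρ Ω x ![v, v])
    {μ : Measure (EuclideanSpace ℝ (Fin (m+1)))}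
    (hμ : μ = (volume.restrict Ω).withDensity fun x => ENNReal.ofReal (Real.exp (-ρ x)))
    {f : EuclideanSpace ℝ (Fin (m+1)) → ℝ} (hf : Integrable f μ) (hf0 : ∫ x, f x ∂μ = 0)
    {x₀ : EuclideanSpace ℝ (Fin (m+1))}
    (hfd : Integrable (fun x => |f x| * ‖x - x₀‖) μ) :
    ∃ (Q : Type) (mQ : MeasurableSpace Q) (ν : @Measure Q mQ)
      (I : Q → Set (EuclideanSpace ℝ (Fin (m+1))))
      (μq : Q → Measure (EuclideanSpace ℝ (Fin (m+1)))),
      (∀ q, (I q).Nonempty) ∧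
      (Pairwise fun q q' => Disjoint (I q) (I q')) ∧
      (⋃ q, I q) = Ω ∧
      (∀ q, ∃ (A : Set ℝ) (γ : ℝ → EuclideanSpace ℝ (Fin (m+1))),
        A.OrdConnected ∧ (∀ s ∈ A, ∀ t ∈ A, ‖γ s - γ t‖ = |s - t|) ∧ I q = γ '' A) ∧
      (∀ B : Set (EuclideanSpace ℝ (Fin (m+1))), MeasurableSet B →
        (@Measurable Q ℝ≥0∞ mQ inferInstance fun q => μq q B) ∧
          μ B = ∫⁻ q, μq q B ∂ν) ∧
      (∀ᵐ q ∂ν, μq q (I q)ᶜ = 0 ∧ ((∃ x, I q = {x}) ∨ Needle κ Ω (μq q))) ∧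
      (∀ᵐ q ∂ν, ∫ x, f x ∂(μq q) = 0) := by
  obtain ⟨u, hu, hopt⟩ := exists_opt hf hf0 hfd
  have hac : μ ≪ volume := by
    rw [hμ]; exact (withDensity_absolutelyContinuous _ _).trans Measure.restrict_le_self.absolutelyContinuous
  have hμΩ : μ Ωᶜ = 0 := by
    rw [hμ]; refine withDensity_absolutelyContinuous _ _ ?_
    rw [Measure.restrict_apply hΩ.measurableSet.compl]; simp
  obtain ⟨e, he⟩ := exists_surjective_nat (Fin (m+1) × ℚ × ℕ)
  let L : ℕ → (((Fin m → ℝ) × ℝ) ≃L[ℝ] EuclideanSpace ℝ (Fin (m+1))) := fun c => Lc (e c).1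
  let r : ℕ → ℝ := fun c => ((e c).2.1 : ℝ)
  let δ : ℕ → ℝ := fun c => 1 / (((e c).2.2 : ℝ) + 1)
  have hδ : ∀ c, 0 < δ c := fun c => by positivity
  let C : ℕ → Set (Fin m → ℝ) := fun c => Cc u Ω (L c) (r c) (δ c)
  let V : ℕ → Set (EuclideanSpace ℝ (Fin (m+1))) := fun c => sat u Ω (L c) (r c) (C c)
  have hch := fun c => chart_main (volume : Measure (Fin m → ℝ)) volume hu hΩ hconv hρ hHess hμ (L c) (r c) (hδ c)
  have hCm : ∀ c, MeasurableSet (C c) := fun c => (hch c).1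
  choose η hη hdis hae using fun c => (hch c).2
  have hVm : ∀ c, MeasurableSet (V c) := fun c => sat_meas hu hΩ (hδ c) subset_rfl (hCm c)
  let H : ℕ → (Fin m → ℝ) → EuclideanSpace ℝ (Fin (m+1)) := fun c y => L c (y, r c)
  have hH : ∀ c, Measurable (H c) := fun c =>
    ((L c).continuous.comp (by fun_prop : Continuous fun y : Fin m → ℝ => (y, r c))).measurable
  let P : ℕ → Set (Fin m → ℝ) := fun c => C c \ (H c ⁻¹' (⋃ d, ⋃ (_ : d < c), V d))
  have hPm : ∀ c, MeasurableSet (P c) := fun c =>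
    (hCm c).diff (hH c (MeasurableSet.iUnion fun d => MeasurableSet.iUnion fun _ => hVm d))
  have hPC : ∀ c, P c ⊆ C c := fun c => Set.sdiff_subset
  let S : ℕ → Set (EuclideanSpace ℝ (Fin (m+1))) := fun c => sat u Ω (L c) (r c) (P c)
  have hSm : ∀ c, MeasurableSet (S c) := fun c => sat_meas hu hΩ (hδ c) (hPC c) (hPm c)
  have hSX : ∀ c, S c ⊆ X u := by
    rintro c z ⟨h1, y, hy, h2⟩
    exact (O_eq hu h2).1
  have hCX : ∀ c, ∀ y ∈ C c, H c y ∈ X u := fun c y hy => R_sub_X hu (hδ c) (hδ c) hy.2.1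
  have hVs : ∀ c z z', z ∈ V c → z ∈ O u z' → z' ∈ Ω → z' ∈ X u → z' ∈ V c := by
    rintro c z z' ⟨h1, y, hy, h2⟩ h3 h4 h5
    refine ⟨h4, y, hy, ?_⟩
    rw [← (O_eq hu h2).2.2, (O_eq hu h3).2.2]; exact mem_O_self h5
  have hSlt : ∀ c d, d < c → Disjoint (S d) (S c) := by
    intro c d hdc
    rw [Set.disjoint_left]
    rintro z ⟨h1, y, hy, h2⟩ ⟨-, y', hy', h2'⟩
    refine hy'.2 (Set.mem_iUnion₂.2 ⟨d, hdc, ?_⟩)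
    exact hVs d z _ ⟨h1, y, hPC d hy, h2⟩ h2' (hPC c hy').1 (hCX c y' (hPC c hy'))
  refine glue (lam := (volume : Measure (Fin m → ℝ))) (Z := Ω \ X u) (P := P) (S := S)
    (hΩ.measurableSet.diff (X_meas hu)) hPm hSm hΩ.measurableSet hμΩ
    (fun c y => O u (H c y) ∩ Ω) ?_ ?_ ?_ ?_ ?_ ?_ η hη
    (fun c B hB => hdis c (P c) (hPm c) (hPC c) B hB)
    (fun J => ∃ (A : Set ℝ) (γ : ℝ → EuclideanSpace ℝ (Fin (m+1))),
        A.OrdConnected ∧ (∀ s ∈ A, ∀ t ∈ A, ‖γ s - γ t‖ = |s - t|) ∧ J = γ '' A) ?_ ?_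
    (Needle κ Ω) ?_ (fun τ => ∫ x, f x ∂τ = 0) ?_ ?_
  · intro c
    ext z
    constructor
    · rintro ⟨h1, y, hy, h2⟩
      exact Set.mem_iUnion₂.2 ⟨y, hy, h2, h1⟩
    · intro h
      obtain ⟨y, hy, h2, h1⟩ := Set.mem_iUnion₂.1 h
      exact ⟨h1, y, hy, h2⟩
  · intro c
    rw [Set.disjoint_left]
    exact fun z hz hz' => hz.2 (hSX c hz')
  · intro c d h
    rcases lt_or_gt_of_ne h with h | h
    · exact hSlt d c h
    · exact (hSlt c d h).symm
  · ext z
    constructor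
    · rintro (h | h)
      · exact h.1
      · obtain ⟨c, hc⟩ := Set.mem_iUnion.1 h
        exact hc.1
    · intro hz
      by_cases hzX : z ∈ X u
      · right
        have hex : ∃ c, z ∈ V c := by
          obtain ⟨i, q, k, h⟩ := chart_cover hu hΩ hzX hz
          obtain ⟨c, hc⟩ := he (i, q, k)
          refine ⟨c, ?_⟩
          show z ∈ sat u Ω (Lc (e c).1) ((e c).2.1 : ℝ)
            (Cc u Ω (Lc (e c).1) ((e c).2.1 : ℝ) (1 / (((e c).2.2 : ℝ) + 1)))
          rw [hc]; exact h
        classical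
        obtain ⟨h1, y, hy, h2⟩ := Nat.find_spec hex
        refine Set.mem_iUnion.2 ⟨Nat.find hex, h1, y, ⟨hy, fun h => ?_⟩, h2⟩
        obtain ⟨d, hd, h3⟩ := Set.mem_iUnion₂.1 h
        refine Nat.find_min hex hd (hVs d _ z h3 ?_ hz hzX)
        rw [(O_eq hu h2).2.2]
        exact mem_O_self (hCX _ y hy)
      · exact Or.inl ⟨hz, hzX⟩
  · intro c y hy y' hy' hne
    rw [Set.disjoint_left]
    exact fun z hz hz' => hne (uniq_base hu (hPC c hy) hz.1 hz'.1)
  · intro c y hy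
    exact ⟨H c y, mem_O_self (hCX c y (hPC c hy)), (hPC c hy).1⟩
  · intro z
    refine ⟨{0}, fun _ => z, Set.ordConnected_singleton, ?_, by simp⟩
    intro s hs t ht
    rw [Set.mem_singleton_iff.1 hs, Set.mem_singleton_iff.1 ht]; simp
  · intro c y hy
    exact ⟨Ay u Ω (H c y), _, Ay_ord hu hconv _, fun s _ t _ =>
      line_isom (vf_norm (hCX c y (hPC c hy))) s t, (Ay_image _).symm⟩
  · intro c
    filter_upwards [hae c] with y h1 h2
    exact h1 (hPC c h2)
  · intro c
    have := fib_zero hf (hCm c) (S := sat u Ω (L c) (r c))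
      (fun P hP hPC => sat_meas hu hΩ (hδ c) hPC hP) (hη c) (hdis c)
      (fun P hP hPC => sat_bal volume hu hΩ (hδ c) hac hμΩ hf hfd hopt hPC hP)
    filter_upwards [this] with y h1 h2
    exact h1 (hPC c h2)
  · filter_upwards [sing_zero volume hu hac hf hfd hopt] with z h1 h2
    rw [integral_dirac]; exact h1 h2.2
end charts
end NL

/-- **Localization theorem (Euclidean case, `N = ∞`)**: on a weighted convex domain
`(Ω, e^{-ρ})` satisfying `CD(κ,∞)` (i.e. `Hess ρ ≥ κ·Id`), any integrable `f` with
`∫ f dμ = 0` and finite first moment yields a partition of `Ω` into unit-speed segments,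
a measure `ν` on the set of pieces and conditional measures `μ_q`, disintegrating `μ`,
such that almost every `μ_q` is a `CD(κ,∞)`-needle (or sits on a singleton piece) and
`∫ f dμ_q = 0` for almost every piece. -/
theorem localization_euclidean {n : ℕ} (hn : 2 ≤ n) (κ : ℝ)
    (Ω : Set (EuclideanSpace ℝ (Fin n))) (hne : Ω.Nonempty) (ho : IsOpen Ω)
    (hconv : Convex ℝ Ω)
    (ρ : EuclideanSpace ℝ (Fin n) → ℝ) (hρ : ContDiffOn ℝ (⊤ : ℕ∞) ρ Ω)
    (hHess : ∀ x ∈ Ω, ∀ v : EuclideanSpace ℝ (Fin n),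
      κ * ‖v‖ ^ 2 ≤ iteratedFDerivWithin ℝ 2 ρ Ω x ![v, v])
    (μ : Measure (EuclideanSpace ℝ (Fin n)))
    (hμ : μ = (volume.restrict Ω).withDensity fun x => ENNReal.ofReal (Real.exp (-ρ x)))
    (f : EuclideanSpace ℝ (Fin n) → ℝ) (hf : Integrable f μ) (hf0 : ∫ x, f x ∂μ = 0)
    (x₀ : EuclideanSpace ℝ (Fin n)) (hx₀ : x₀ ∈ Ω)
    (hfd : Integrable (fun x => |f x| * ‖x - x₀‖) μ) :
    ∃ (Q : Type) (m : MeasurableSpace Q) (ν : @Measure Q m)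
      (I : Q → Set (EuclideanSpace ℝ (Fin n)))
      (μq : Q → Measure (EuclideanSpace ℝ (Fin n))),
      (∀ q, (I q).Nonempty) ∧
      (Pairwise fun q q' => Disjoint (I q) (I q')) ∧
      (⋃ q, I q) = Ω ∧
      (∀ q, ∃ (A : Set ℝ) (γ : ℝ → EuclideanSpace ℝ (Fin n)),
        A.OrdConnected ∧ (∀ s ∈ A, ∀ t ∈ A, ‖γ s - γ t‖ = |s - t|) ∧ I q = γ '' A) ∧
      (∀ B : Set (EuclideanSpace ℝ (Fin n)), MeasurableSet B →
        (@Measurable Q ℝ≥0∞ m inferInstance fun q => μq q B) ∧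
          μ B = ∫⁻ q, μq q B ∂ν) ∧
      (∀ᵐ q ∂ν, μq q (I q)ᶜ = 0 ∧ ((∃ x, I q = {x}) ∨ IsCDNeedle κ Ω (μq q))) ∧
      (∀ᵐ q ∂ν, ∫ x, f x ∂(μq q) = 0) := by
  obtain ⟨m, rfl⟩ : ∃ m, n = m + 1 := ⟨n - 1, by omega⟩
  exact NL.main ho hconv hρ hHess hμ hf hf0 hfd
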